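/- arXiv:1904.01285 — 4 statements merged into one kernel-verified Lean document; each statement's English description precedes it below -/
import Mathlib

section
/- For every countable ordinal λ ≥ 1, there exists a closed countable set X ⊆ [0,1] and an equalizing closed symmetric reflexive relation E ⊆ X² whose close-up rank is λ; furthermore, if λ > 2 is an odd ordinal (i.e., of the form μ + 2n + 1 with μ a limit ordinal and n ∈ ℕ), then for every k ≥ 1, (E^[k])² is contained in the closure of (E^(λ-1))^[2k] ∩ (E^[k])². -/
open Filter Topology Set

namespace CPE

universe u

/-- The left shift map on bi-infinite sequences: `(σ x) i = x (i+1)`. -/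
def shiftMap {A : Type*} (x : ℤ → A) : ℤ → A := fun i => x (i + 1)

/-- The shift by `m`: `(σ^m x) i = x (i + m)`. -/
def shiftZ {A : Type*} (m : ℤ) (x : ℤ → A) : ℤ → A := fun i => x (i + m)

/-- A subshift: a closed shift-invariant subset of the full shift. -/
def IsSubshift {A : Type*} [TopologicalSpace A] (X : Set (ℤ → A)) : Prop :=
  IsClosed X ∧ shiftMap '' X = X

/-- The orbit closure of a point. -/
def orbitClosure {A : Type*} [TopologicalSpace A] (x : ℤ → A) : Set (ℤ → A) :=
  closure {y | ∃ m : ℤ, y = shiftZ m x}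

/-- A Toeplitz point: every coordinate repeats along some arithmetic progression. -/
def IsToeplitz {A : Type*} (x : ℤ → A) : Prop :=
  ∀ i : ℤ, ∃ n : ℕ, 0 < n ∧ ∀ m : ℤ, x (i + m * n) = x i

/-- A minimal subshift: a nonempty subshift with no nonempty proper subshift. -/
def IsMinimalSubshift {A : Type*} [TopologicalSpace A] (M : Set (ℤ → A)) : Prop :=
  IsSubshift M ∧ M.Nonempty ∧ ∀ M' ⊆ M, IsSubshift M' → M'.Nonempty → M' = M

/-- The words of length `n` appearing in points of `X`. -/
def lang {A : Type*} (X : Set (ℤ → A)) (n : ℕ) : Set (Fin n → A) :=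
  {w | ∃ x ∈ X, ∀ i : Fin n, x (i : ℤ) = w i}

/-- `X` has zero (topological) entropy: `lim (log |L_n(X)|)/n = 0`. -/
def HasZeroEntropy {A : Type*} (X : Set (ℤ → A)) : Prop :=
  Tendsto (fun n : ℕ => Real.log ((lang X n).ncard) / n) atTop (nhds 0)

/-- `N(𝒰 ∨ σ⁻¹𝒰 ∨ ⋯ ∨ σ^{-(n-1)}𝒰)` for the two-element cover `𝒰 = (C0, C1)`:
the minimal number of sets of the form `⋂_{i<n} σ^{-i} C_{u i}` needed to cover `X`. -/
noncomputable def coverNum {A : Type*} (X C0 C1 : Set (ℤ → A)) (n : ℕ) : ℕ :=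
  sInf {m | ∃ S : Finset (Fin n → Bool), S.card = m ∧
    X ⊆ ⋃ u ∈ S, ⋂ i : Fin n, shiftMap^[(i : ℕ)] ⁻¹' (if u i then C1 else C0)}

/-- The topological entropy `h(𝒰)` of the two-element cover `𝒰 = (C0, C1)` of a subshift `X`.
By subadditivity (Fekete's lemma) the limit `lim_n (1/n) log N_n` exists and equals the
infimum `⨅_{n ≥ 1} (1/n) log N_n`, which we use as the definition. -/
noncomputable def coverEntropy {A : Type*} (X C0 C1 : Set (ℤ → A)) : ℝ :=
  ⨅ n : ℕ, Real.log (coverNum X C0 C1 (n + 1)) / (n + 1)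

/-- `(x, y)` is an entropy pair of the subshift `X`: `x ≠ y` and for all disjoint closed
neighborhoods `U` of `x` and `V` of `y` (in `X`), the cover `(Uᶜ, Vᶜ)` has positive entropy. -/
def IsEntropyPair {A : Type*} [TopologicalSpace A] (X : Set (ℤ → A)) (x y : ℤ → A) : Prop :=
  x ∈ X ∧ y ∈ X ∧ x ≠ y ∧
    ∀ U V : Set (ℤ → A), IsClosed U → IsClosed V → U ∈ nhdsWithin x X → V ∈ nhdsWithin y X →
      Disjoint U V → 0 < coverEntropy X Uᶜ Vᶜ

/-- `EP(X)`: the entropy pairs of `X` together with the diagonal on `X`. -/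
def EP {A : Type*} [TopologicalSpace A] (X : Set (ℤ → A)) : Set ((ℤ → A) × (ℤ → A)) :=
  {p | IsEntropyPair X p.1 p.2} ∪ {p | p.1 ∈ X ∧ p.1 = p.2}

/-- The close-up process on a relation `E`: `E^(0) = E`; at a successor step `α + 1` one takes
the topological closure if `α + 1` is odd (i.e. `α` is even), and the transitive closure if
`α + 1` is even (i.e. `α` is odd); at limit steps one takes the union.  (An ordinal is even
iff it is of the form `λ + 2n` with `λ` a limit ordinal and `n ∈ ℕ`, iff its residue mod `2`
is `0`.)  When `E` is closed this agrees with the process of Barbieri–García-Ramos started at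
`E^(1) = E`, since then `E^(1) = closure E = E`. -/
noncomputable def closeUp {α : Type u} [TopologicalSpace α] (E : Set (α × α))
    (o : Ordinal.{u}) : Set (α × α) :=
  Ordinal.limitRecOn o E
    (fun β ih => if β % 2 = 0 then closure ih
      else {p | Relation.TransGen (fun a b => (a, b) ∈ ih) p.1 p.2})
    (fun β _ ih => ⋃ γ : Set.Iio β, ih γ.1 γ.2)

/-- The close-up rank of `E`: the least ordinal `λ` (with `λ ≥ 1` if `E` is closed, matching
the convention `E^(ζ) = E`, `ζ = 1` for closed `E`) such that `E^(λ) = E^(λ+1)`. -/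
noncomputable def closeUpRank {α : Type u} [TopologicalSpace α] (E : Set (α × α)) :
    Ordinal.{u} :=
  sInf {o | (IsClosed E → 1 ≤ o) ∧ closeUp E o = closeUp E (o + 1)}

/-- `E^[k] = {(x₁, …, x_k) : ∀ i j, (x_i, x_j) ∈ E}`. -/
def relPow {α : Type*} (E : Set (α × α)) (k : ℕ) : Set (Fin k → α) :=
  {v | ∀ i j, (v i, v j) ∈ E}

/-- `(E^[k])²` viewed inside `α^{k+k}` via concatenation of the two `k`-tuples. -/
def pairSet {α : Type*} (E : Set (α × α)) (k : ℕ) : Set (Fin (k + k) → α) :=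
  {w | ∃ u ∈ relPow E k, ∃ v ∈ relPow E k, w = Fin.append u v}

end CPE

namespace CPE

open Order

section Parity

theorem add_one_mod_two_of_even {o : Ordinal} (h : o % 2 = 0) : (o + 1) % 2 = 1 := by
  have h1 := Ordinal.div_add_mod o 2
  rw [h, add_zero] at h1
  rw [← h1, Ordinal.mul_add_mod_self]
  exact Ordinal.mod_eq_of_lt one_lt_two

theorem mod_two_eq_one_of_ne_zero {o : Ordinal} (h : o % 2 ≠ 0) : o % 2 = 1 := by
  have h1 : o % 2 < 1 + 1 := by
    rw [one_add_one_eq_two]; exact Ordinal.mod_lt o two_ne_zero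
  exact le_antisymm (lt_add_one_iff.1 h1) (one_le_iff_ne_zero.2 h)

theorem add_one_mod_two_of_odd {o : Ordinal} (h : o % 2 ≠ 0) : (o + 1) % 2 = 0 := by
  have h1 := Ordinal.div_add_mod o 2
  rw [mod_two_eq_one_of_ne_zero h] at h1
  have h2 : o + 1 = 2 * (o / 2 + 1) := by
    rw [mul_add, mul_one, ← one_add_one_eq_two, ← add_assoc, one_add_one_eq_two, h1]
  rw [h2, Ordinal.mul_mod]

theorem mod_two_of_isSuccLimit {o : Ordinal} (h : IsSuccLimit o) : o % 2 = 0 := by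
  by_contra h0
  have h1 := Ordinal.div_add_mod o 2
  rw [mod_two_eq_one_of_ne_zero h0] at h1
  exact (h.succ_lt (show 2 * (o / 2) < o from (lt_add_one _).trans_eq h1)).ne
    (by rw [succ_eq_add_one, h1])

end Parity

section CloseUp

variable {α : Type*} [TopologicalSpace α] {E : Set (α × α)}

/-- The transitive closure of a relation given as a set of pairs. -/
def transClosure {α : Type*} (R : Set (α × α)) : Set (α × α) :=
  {p | Relation.TransGen (fun a b => (a, b) ∈ R) p.1 p.2}

theorem subset_transClosure {α : Type*} (R : Set (α × α)) : R ⊆ transClosure R :=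
  fun _ hp => Relation.TransGen.single hp

theorem closeUp_zero (E : Set (α × α)) : closeUp E 0 = E := by simp [closeUp]

theorem closeUp_add_one_of_even (E : Set (α × α)) {o : Ordinal} (h : o % 2 = 0) :
    closeUp E (o + 1) = closure (closeUp E o) := by
  simp [closeUp, h]

theorem closeUp_add_one_of_odd (E : Set (α × α)) {o : Ordinal} (h : o % 2 ≠ 0) :
    closeUp E (o + 1) = transClosure (closeUp E o) := by
  simp [closeUp, h, transClosure]

theorem closeUp_limit (E : Set (α × α)) {o : Ordinal} (h : IsSuccLimit o) :
    closeUp E o = ⋃ γ : Iio o, closeUp E γ.1 := by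
  simp only [closeUp, Ordinal.limitRecOn_limit _ _ _ _ h]

theorem mem_closeUp_limit {o : Ordinal} (h : IsSuccLimit o) {p : α × α} :
    p ∈ closeUp E o ↔ ∃ γ < o, p ∈ closeUp E γ := by
  rw [closeUp_limit E h]; simp

theorem closeUp_subset_add_one (E : Set (α × α)) (o : Ordinal) :
    closeUp E o ⊆ closeUp E (o + 1) := by
  by_cases h : o % 2 = 0
  · rw [closeUp_add_one_of_even E h]; exact subset_closure
  · rw [closeUp_add_one_of_odd E h]; exact subset_transClosure _

theorem closeUp_mono (E : Set (α × α)) : Monotone (closeUp E) := by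
  intro o o' h
  induction o' using Ordinal.limitRecOn with
  | zero => rw [nonpos_iff_eq_zero.1 h]
  | add_one o' ih =>
    rcases h.eq_or_lt with rfl | h
    · rfl
    · exact (ih (lt_add_one_iff.1 h)).trans (closeUp_subset_add_one E o')
  | limit o' ho' ih =>
    rcases h.eq_or_lt with rfl | h
    · rfl
    · exact fun p hp => (mem_closeUp_limit ho').2 ⟨o, h, hp⟩

theorem subset_closeUp (E : Set (α × α)) (o : Ordinal) :
    E ⊆ closeUp E o := by
  simpa only [closeUp_zero] using closeUp_mono E (zero_le (a := o))

theorem closeUp_trans {o : Ordinal} (h : o % 2 = 0) (h0 : o ≠ 0) {a b c : α}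
    (hab : (a, b) ∈ closeUp E o) (hbc : (b, c) ∈ closeUp E o) : (a, c) ∈ closeUp E o := by
  have key : ∀ (o : Ordinal), o % 2 ≠ 0 → ∀ {a b c : α}, (a, b) ∈ closeUp E (o + 1) →
      (b, c) ∈ closeUp E (o + 1) → (a, c) ∈ closeUp E (o + 1) := by
    intro o ho a b c hab hbc
    rw [closeUp_add_one_of_odd E ho] at hab hbc ⊢
    exact Relation.TransGen.trans hab hbc
  rcases Ordinal.zero_or_succ_or_isSuccLimit o with rfl | ⟨o, rfl⟩ | ho
  · exact absurd rfl h0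
  · rw [succ_eq_add_one] at *
    refine key o (fun h1 => ?_) hab hbc
    rw [add_one_mod_two_of_even h1] at h
    exact one_ne_zero h
  · obtain ⟨γ, hγ, h1⟩ := (mem_closeUp_limit ho).1 hab
    obtain ⟨δ, hδ, h2⟩ := (mem_closeUp_limit ho).1 hbc
    obtain ⟨ε, hε, hε1, hγε, hδε⟩ : ∃ ε < o, ε % 2 ≠ 0 ∧ γ ≤ ε ∧ δ ≤ ε := by
      by_cases hm : max γ δ % 2 = 0
      · refine ⟨max γ δ + 1, ho.succ_lt (max_lt hγ hδ), ?_, ?_, ?_⟩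
        · rw [add_one_mod_two_of_even hm]; exact one_ne_zero
        · exact (le_max_left _ _).trans (lt_add_one _).le
        · exact (le_max_right _ _).trans (lt_add_one _).le
      · exact ⟨max γ δ, max_lt hγ hδ, hm, le_max_left _ _, le_max_right _ _⟩
    have hle := (lt_add_one ε).le
    exact (mem_closeUp_limit ho).2 ⟨ε + 1, ho.succ_lt hε,
      key ε hε1 (closeUp_mono E (hγε.trans hle) h1) (closeUp_mono E (hδε.trans hle) h2)⟩

theorem transClosure_closeUp_of_even {o : Ordinal} (h : o % 2 = 0) (h0 : o ≠ 0) :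
    transClosure (closeUp E o) = closeUp E o := by
  refine Subset.antisymm ?_ (subset_transClosure _)
  rintro ⟨a, b⟩ hab
  exact Relation.TransGen.trans_induction_on (motive := fun {a b} _ => (a, b) ∈ closeUp E o)
    hab (fun h => h) (fun _ _ h1 h2 => closeUp_trans h h0 h1 h2)

theorem closeUp_eq_of_stable {o : Ordinal} (h1 : 1 ≤ o) (h : closeUp E o = closeUp E (o + 1))
    {o' : Ordinal} (ho : o ≤ o') : closeUp E o' = closeUp E o := by
  have hfix : closure (closeUp E o) = closeUp E o ∧ transClosure (closeUp E o) = closeUp E o := by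
    by_cases hp : o % 2 = 0
    · exact ⟨by rw [← closeUp_add_one_of_even E hp, h],
        transClosure_closeUp_of_even hp (one_le_iff_ne_zero.1 h1)⟩
    · refine ⟨?_, by rw [← closeUp_add_one_of_odd E hp, h]⟩
      rcases Ordinal.zero_or_succ_or_isSuccLimit o with rfl | ⟨o, rfl⟩ | hl
      · simp at h1
      · rw [succ_eq_add_one] at *
        have : o % 2 = 0 := by_contra fun h2 => hp (add_one_mod_two_of_odd h2)
        rw [closeUp_add_one_of_even E this, closure_closure]
      · exact absurd (mod_two_of_isSuccLimit hl) hp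
  induction o' using Ordinal.limitRecOn with
  | zero => rw [nonpos_iff_eq_zero.1 ho]
  | add_one o' ih =>
    rcases ho.eq_or_lt with rfl | ho
    · rfl
    · have := ih (lt_add_one_iff.1 ho)
      by_cases hp : o' % 2 = 0
      · rw [closeUp_add_one_of_even E hp, this, hfix.1]
      · rw [closeUp_add_one_of_odd E hp, this, hfix.2]
  | limit o' hl ih =>
    refine Subset.antisymm (fun p hp => ?_) (closeUp_mono E ho)
    obtain ⟨γ, hγ, hp⟩ := (mem_closeUp_limit hl).1 hp
    rcases le_total o γ with hle | hle
    · rwa [ih γ hγ hle] at hp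
    · exact closeUp_mono E hle hp

theorem closeUpRank_eq {α : Type} [TopologicalSpace α] {E : Set (α × α)} {o : Ordinal}
    (h1 : 1 ≤ o) (hE : IsClosed E) (hfull : closeUp E o = univ)
    (hlt : ∀ γ < o, 1 ≤ γ → closeUp E γ ≠ univ) : closeUpRank E = o := by
  have hmem : o ∈ {o | (IsClosed E → 1 ≤ o) ∧ closeUp E o = closeUp E (o + 1)} := by
    refine ⟨fun _ => h1, Subset.antisymm (closeUp_subset_add_one E o) ?_⟩
    rw [hfull]; exact subset_univ _
  refine le_antisymm (csInf_le' hmem) (le_csInf ⟨o, hmem⟩ ?_)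
  rintro γ ⟨hγ1, hγ⟩
  by_contra! hlt'
  exact hlt γ hlt' (hγ1 hE) (by rw [← closeUp_eq_of_stable (hγ1 hE) hγ hlt'.le, hfull])

/-- The close-up process is functorial for continuous maps. -/
theorem closeUp_map {α β : Type} [TopologicalSpace α] [TopologicalSpace β] {E : Set (α × α)}
    {F : Set (β × β)} {f : α → β} (hf : Continuous f)
    (h : ∀ a b, (a, b) ∈ E → (f a, f b) ∈ F) (o : Ordinal) {a b : α}
    (hab : (a, b) ∈ closeUp E o) : (f a, f b) ∈ closeUp F o := by
  induction o using Ordinal.limitRecOn generalizing a b with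
  | zero => rw [closeUp_zero] at *; exact h a b hab
  | add_one o ih =>
    by_cases hp : o % 2 = 0
    · rw [closeUp_add_one_of_even _ hp] at *
      exact map_mem_closure (f := Prod.map f f) (hf.prodMap hf) hab (fun p hp => ih hp)
    · rw [closeUp_add_one_of_odd _ hp] at *
      exact Relation.TransGen.lift (p := fun a b => (a, b) ∈ closeUp F o) f
        (fun _ _ h => ih h) _ _ hab
  | limit o ho ih =>
    obtain ⟨γ, hγ, hp⟩ := (mem_closeUp_limit ho).1 hab
    exact (mem_closeUp_limit ho).2 ⟨γ, hγ, ih γ hγ hp⟩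

theorem closeUp_image {α β : Type} [TopologicalSpace α] [TopologicalSpace β] {f : α → β}
    (hf : IsClosedEmbedding f) (E : Set (α × α)) (o : Ordinal) :
    closeUp (Prod.map f f '' E) o = Prod.map f f '' closeUp E o := by
  induction o using Ordinal.limitRecOn with
  | zero => simp only [closeUp_zero]
  | add_one o ih =>
    by_cases hp : o % 2 = 0
    · rw [closeUp_add_one_of_even _ hp, closeUp_add_one_of_even _ hp, ih,
        (hf.prodMap hf).closure_image_eq]
    · rw [closeUp_add_one_of_odd _ hp, closeUp_add_one_of_odd _ hp, ih]
      ext ⟨x, y⟩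
      constructor
      · intro h
        change Relation.TransGen _ x y at h
        induction h with
        | single h =>
          obtain ⟨p, hp, hxy⟩ := h
          exact ⟨p, subset_transClosure _ hp, hxy⟩
        | tail _ h ih =>
          obtain ⟨⟨a, b⟩, hab, heq⟩ := ih
          obtain ⟨⟨c, d⟩, hcd, heq'⟩ := h
          simp only [Prod.map, Prod.mk.injEq] at heq heq'
          obtain rfl : b = c := hf.injective (heq.2.trans heq'.1.symm)
          exact ⟨(a, d), Relation.TransGen.tail hab hcd, Prod.ext heq.1 heq'.2⟩
      · rintro ⟨⟨a, b⟩, hab, heq⟩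
        simp only [Prod.map, Prod.mk.injEq] at heq
        obtain ⟨rfl, rfl⟩ := heq
        exact Relation.TransGen.lift (p := fun x y => (x, y) ∈ Prod.map f f '' closeUp E o) f
          (fun c d h => ⟨(c, d), h, rfl⟩) _ _ hab
  | limit o ho ih =>
    rw [closeUp_limit _ ho, closeUp_limit _ ho, image_iUnion]
    exact iUnion_congr fun γ => ih γ.1 γ.2

theorem closeUpRank_image {α β : Type} [TopologicalSpace α] [TopologicalSpace β] {f : α → β}
    (hf : IsClosedEmbedding f) (E : Set (α × α)) :
    closeUpRank (Prod.map f f '' E) = closeUpRank E := by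
  have hinj := (hf.prodMap hf).injective.image_injective
  simp only [closeUpRank, closeUp_image hf, hinj.eq_iff,
    ← (hf.prodMap hf).isClosed_iff_image_isClosed]

end CloseUp

open OnePoint

/-- A countable compact space embedded in `[0, 1]`, with a closed reflexive symmetric relation. -/
structure Gadget where
  /-- The underlying space. -/
  carrier : Type
  [topology : TopologicalSpace carrier]
  [compactSpace : CompactSpace carrier]
  [countable : Countable carrier]
  /-- The embedding into the unit interval. -/
  toReal : carrier → ℝ
  continuous_toReal : Continuous toReal
  injective_toReal : Function.Injective toReal
  toReal_mem : ∀ x, toReal x ∈ Icc (0 : ℝ) 1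
  /-- The relation. -/
  rel : Set (carrier × carrier)
  isClosed_rel : IsClosed rel
  refl_rel : ∀ x, (x, x) ∈ rel
  symm_rel : ∀ x y, (x, y) ∈ rel → (y, x) ∈ rel

namespace Gadget

attribute [instance] topology compactSpace countable

section Sum

variable (G : ℕ → Gadget)

/-- The one-point compactification of the disjoint union of a sequence of gadgets. -/
abbrev SumSpace : Type := OnePoint (Σ n, (G n).carrier)

variable {G}

/-- The inclusion of the `n`-th summand. -/
def incl (n : ℕ) (x : (G n).carrier) : SumSpace G := ((⟨n, x⟩ : Σ n, (G n).carrier) : OnePoint _)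

theorem sumSpace_cases {P : SumSpace G → Prop} (hinf : P ∞) (h : ∀ n x, P (incl n x)) :
    ∀ z, P z := by
  intro z
  induction z using OnePoint.rec with
  | infty => exact hinf
  | coe z => exact h z.1 z.2

theorem eventually_lt_coclosedCompact (N : ℕ) :
    ∀ᶠ z in coclosedCompact (Σ n, (G n).carrier), N < z.1 := by
  have hs : {z : Σ n, (G n).carrier | z.1 ≤ N} = ⋃ n ∈ Iic N, range (Sigma.mk n) := by
    ext ⟨m, x⟩
    simp only [mem_ofPred_eq, mem_iUnion, mem_range, mem_Iic]
    constructor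
    · exact fun h => ⟨m, h, x, rfl⟩
    · rintro ⟨n, hn, y, hy⟩
      have : n = m := congrArg Sigma.fst hy
      exact this ▸ hn
  have hcl : IsClosed {z : Σ n, (G n).carrier | z.1 ≤ N} := by
    rw [hs]
    exact (finite_Iic N).isClosed_biUnion fun n _ => isClosed_range_sigmaMk
  have hco : IsCompact {z : Σ n, (G n).carrier | z.1 ≤ N} := by
    rw [hs]
    exact (finite_Iic N).isCompact_biUnion fun n _ => isCompact_range continuous_sigmaMk
  filter_upwards [hco.compl_mem_coclosedCompact_of_isClosed hcl] with z hz
  simpa using hz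

theorem continuous_sumSpace {Y : Type*} [TopologicalSpace Y] {f : SumSpace G → Y}
    (h : ∀ n, Continuous fun x => f (incl n x))
    (hinf : Tendsto (fun z : Σ n, (G n).carrier => f z) (coclosedCompact _) (𝓝 (f ∞))) :
    Continuous f :=
  (OnePoint.continuous_iff f).2 ⟨hinf, continuous_sigma h⟩

theorem isOpenEmbedding_incl (n : ℕ) : IsOpenEmbedding (incl (G := G) n) :=
  isOpenEmbedding_coe.comp IsOpenEmbedding.sigmaMk

theorem tendsto_incl (x : ∀ n, (G n).carrier) :
    Tendsto (fun n => incl n (x n)) atTop (𝓝 (∞ : SumSpace G)) := by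
  refine tendsto_coe_infty.comp (x := atTop) (f := fun n => (⟨n, x n⟩ : Σ n, (G n).carrier)) ?_
  refine hasBasis_coclosedCompact.tendsto_right_iff.2 fun K ⟨_, hK⟩ => ?_
  obtain ⟨N, hN⟩ := (hK.image (f := fun z : Σ n, (G n).carrier => z.1)
    (continuous_sigma fun _ => continuous_const)).bddAbove
  filter_upwards [eventually_gt_atTop N] with n hn hmem
  exact hn.not_ge (hN ⟨_, hmem, rfl⟩)

variable (a q : ∀ n, (G n).carrier)

/-- The retraction of the sum onto its `n`-th summand which collapses the earlier summands to
`a n`, and the later ones together with the point at infinity to `q n`. -/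
noncomputable def retract (n : ℕ) : SumSpace G → (G n).carrier :=
  fun w => w.elim (q n) fun z =>
    if h : z.1 = n then h ▸ z.2 else if z.1 < n then a n else q n

theorem retract_infty (n : ℕ) : retract a q n ∞ = q n := rfl

theorem retract_self (n : ℕ) (x : (G n).carrier) : retract a q n (incl n x) = x := by
  simp [retract, incl]

theorem retract_of_lt {m n : ℕ} (h : m < n) (x : (G m).carrier) :
    retract a q n (incl m x) = a n := by
  simp [retract, incl, h, h.ne]

theorem retract_of_gt {m n : ℕ} (h : n < m) (x : (G m).carrier) :
    retract a q n (incl m x) = q n := by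
  simp [retract, incl, h.not_gt, h.ne']

theorem continuous_retract (n : ℕ) : Continuous (retract a q n) := by
  refine continuous_sumSpace (fun m => ?_) ?_
  · rcases lt_trichotomy m n with h | rfl | h
    · simp only [retract_of_lt a q h]; exact continuous_const
    · simp only [retract_self]; exact continuous_id
    · simp only [retract_of_gt a q h]; exact continuous_const
  · refine tendsto_const_nhds.congr' ?_
    filter_upwards [eventually_lt_coclosedCompact n] with z hz
    exact (retract_of_gt a q hz z.2).symm

/-- The embedding of the sum into the unit interval. -/
noncomputable def sumToReal : SumSpace G → ℝ :=
  fun w => w.elim 0 fun z => (1 + (G z.1).toReal z.2) * (1 / 3) ^ (z.1 + 1)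

theorem sumToReal_infty : sumToReal (∞ : SumSpace G) = 0 := rfl

theorem sumToReal_incl (n : ℕ) (x : (G n).carrier) :
    sumToReal (incl n x) = (1 + (G n).toReal x) * (1 / 3) ^ (n + 1) := rfl

theorem le_sumToReal_incl (n : ℕ) (x : (G n).carrier) :
    (1 / 3) ^ (n + 1) ≤ sumToReal (incl n x) := by
  rw [sumToReal_incl]
  exact le_mul_of_one_le_left (by positivity) (by linarith [((G n).toReal_mem x).1])

theorem sumToReal_incl_lt (n : ℕ) (x : (G n).carrier) :
    sumToReal (incl n x) < (1 / 3) ^ n := by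
  rw [sumToReal_incl, pow_succ]
  have h : (0 : ℝ) < (1 / 3) ^ n := by positivity
  nlinarith [((G n).toReal_mem x).2]

theorem continuous_sumToReal : Continuous (sumToReal (G := G)) := by
  refine continuous_sumSpace (fun n => ?_) ?_
  · simp only [sumToReal_incl]
    exact (continuous_const.add (G n).continuous_toReal).mul continuous_const
  · rw [sumToReal_infty, Metric.tendsto_nhds]
    intro ε hε
    obtain ⟨N, hN⟩ := exists_pow_lt_of_lt_one hε (show (1 / 3 : ℝ) < 1 by norm_num)
    filter_upwards [eventually_lt_coclosedCompact N] with z hz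
    have h1 := le_sumToReal_incl z.1 z.2
    have h2 := sumToReal_incl_lt z.1 z.2
    have h3 : (0 : ℝ) < (1 / 3) ^ (z.1 + 1) := by positivity
    have h4 : (1 / 3 : ℝ) ^ z.1 ≤ (1 / 3) ^ N :=
      pow_le_pow_of_le_one (by norm_num) (by norm_num) hz.le
    change dist (sumToReal (incl z.1 z.2)) 0 < ε
    rw [Real.dist_0_eq_abs, abs_of_pos (h3.trans_le h1)]
    linarith

theorem sumToReal_incl_lt_of_lt {m n : ℕ} (h : n < m) (x : (G m).carrier) (y : (G n).carrier) :
    sumToReal (incl m x) < sumToReal (incl n y) :=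
  (sumToReal_incl_lt m x).trans_le ((pow_le_pow_of_le_one (by norm_num) (by norm_num) h).trans
    (le_sumToReal_incl n y))

theorem sumToReal_incl_pos (n : ℕ) (x : (G n).carrier) : 0 < sumToReal (incl n x) :=
  (by positivity : (0 : ℝ) < (1 / 3) ^ (n + 1)).trans_le (le_sumToReal_incl n x)

theorem injective_sumToReal : Function.Injective (sumToReal (G := G)) := by
  intro z w
  induction z using sumSpace_cases with
  | hinf =>
    induction w using sumSpace_cases with
    | hinf => exact fun _ => rfl
    | h m y => exact fun h => absurd h (sumToReal_incl_pos m y).ne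
  | h n x =>
    induction w using sumSpace_cases with
    | hinf => exact fun h => absurd h (sumToReal_incl_pos n x).ne'
    | h m y =>
      intro h
      rcases lt_trichotomy m n with hmn | rfl | hmn
      · exact absurd h (sumToReal_incl_lt_of_lt hmn x y).ne
      · rw [sumToReal_incl, sumToReal_incl] at h
        have := mul_right_cancel₀ (by positivity) h
        rw [(G m).injective_toReal (add_left_cancel this)]
      · exact absurd h (sumToReal_incl_lt_of_lt hmn y x).ne'

/-- The sum of a sequence of gadgets: two points are related when all their retractions are. -/
noncomputable def sum : Gadget where
  carrier := SumSpace G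
  countable := inferInstanceAs (Countable (Option _))
  toReal := sumToReal
  continuous_toReal := continuous_sumToReal
  injective_toReal := injective_sumToReal
  toReal_mem := by
    intro z
    induction z using sumSpace_cases with
    | hinf => rw [sumToReal_infty]; simp
    | h n x =>
      exact ⟨(sumToReal_incl_pos n x).le, (sumToReal_incl_lt n x).le.trans
        (pow_le_one₀ (by norm_num) (by norm_num))⟩
  rel := {z | ∀ n, (retract a q n z.1, retract a q n z.2) ∈ (G n).rel}
  isClosed_rel := by
    rw [ofPred_forall]
    exact isClosed_iInter fun n => (G n).isClosed_rel.preimage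
      ((continuous_retract a q n).prodMap (continuous_retract a q n))
  refl_rel _ n := (G n).refl_rel _
  symm_rel _ _ h n := (G n).symm_rel _ _ (h n)

variable {a q}

theorem retract_mem_closeUp (n : ℕ) {o : Ordinal} {z w : SumSpace G}
    (h : (z, w) ∈ closeUp (sum a q).rel o) :
    (retract a q n z, retract a q n w) ∈ closeUp (G n).rel o :=
  closeUp_map (E := (sum a q).rel) (continuous_retract a q n) (fun _ _ h => h n) o h

theorem incl_mem_closeUp (n : ℕ) {o : Ordinal} {x y : (G n).carrier}
    (h : (x, y) ∈ closeUp (G n).rel o) :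
    ((incl n x : SumSpace G), incl n y) ∈ closeUp (sum a q).rel o := by
  refine closeUp_map (F := (sum a q).rel) (isOpenEmbedding_incl n).continuous ?_ o h
  intro x y hxy m
  rcases lt_trichotomy n m with h | rfl | h
  · simpa only [retract_of_lt a q h] using (G m).refl_rel _
  · simpa only [retract_self] using hxy
  · simpa only [retract_of_gt a q h] using (G m).refl_rel _

theorem link_mem_rel (n : ℕ) :
    ((incl n (q n) : SumSpace G), incl (n + 1) (a (n + 1))) ∈ (sum a q).rel := by
  intro m
  rcases lt_trichotomy m n with h | rfl | h
  · simpa only [retract_of_gt a q h, retract_of_gt a q (h.trans n.lt_succ_self)]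
      using (G m).refl_rel _
  · simpa only [retract_self, retract_of_gt a q m.lt_succ_self] using (G m).refl_rel _
  · rcases (Nat.succ_le_iff.2 h).eq_or_lt with rfl | h'
    · simpa only [retract_of_lt a q h, retract_self] using (G _).refl_rel _
    · simpa only [retract_of_lt a q h, retract_of_lt a q h'] using (G _).refl_rel _

theorem infty_mem_rel (n : ℕ) : ((∞ : SumSpace G), incl n (q n)) ∈ (sum q q).rel := by
  intro m
  rcases lt_trichotomy n m with h | rfl | h
  · simpa only [retract_infty, retract_of_lt q q h] using (G m).refl_rel _
  · simpa only [retract_infty, retract_self] using (G n).refl_rel _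
  · simpa only [retract_infty, retract_of_gt q q h] using (G m).refl_rel _

theorem incl_mem_closeUp_of_full {o : Ordinal} (ho : o % 2 = 0) (h0 : o ≠ 0)
    (hfull : ∀ n, closeUp (G n).rel o = univ) (n m : ℕ) (x : (G n).carrier) (y : (G m).carrier) :
    ((incl n x : SumSpace G), incl m y) ∈ closeUp (sum a q).rel o := by
  have hn : ∀ n (x y : (G n).carrier),
      ((incl n x : SumSpace G), incl n y) ∈ closeUp (sum a q).rel o :=
    fun n x y => incl_mem_closeUp n (by rw [hfull]; trivial)
  have hl := fun n => subset_closeUp _ o (link_mem_rel (a := a) (q := q) n)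
  have hr := fun n => subset_closeUp _ o ((sum a q).symm_rel _ _ (link_mem_rel (a := a) (q := q) n))
  have key : ∀ n (x : (G n).carrier), ((incl n x : SumSpace G), incl 0 (q 0)) ∈
      closeUp (sum a q).rel o ∧ ((incl 0 (q 0) : SumSpace G), incl n x) ∈
      closeUp (sum a q).rel o := by
    intro n
    induction n with
    | zero => exact fun x => ⟨hn 0 _ _, hn 0 _ _⟩
    | succ n ih =>
      exact fun x => ⟨closeUp_trans ho h0 (hn _ _ _) (closeUp_trans ho h0 (hr n) (ih _).1),
        closeUp_trans ho h0 (ih _).2 (closeUp_trans ho h0 (hl n) (hn _ _ _))⟩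
  exact closeUp_trans ho h0 (key n x).1 (key m y).2

theorem closeUp_star_eq_univ {o : Ordinal} (ho : o % 2 = 0) (h0 : o ≠ 0)
    (hfull : ∀ n, closeUp (G n).rel o = univ) : closeUp (sum q q).rel o = univ := by
  have hi := subset_closeUp _ o (infty_mem_rel (q := q) 0)
  have hi' := subset_closeUp _ o ((sum q q).symm_rel _ _ (infty_mem_rel (q := q) 0))
  have hr := subset_closeUp _ o ((sum q q).refl_rel (∞ : SumSpace G))
  have hc := incl_mem_closeUp_of_full (a := q) (q := q) ho h0 hfull
  rw [eq_univ_iff_forall]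
  rintro ⟨z, w⟩
  induction z using sumSpace_cases with
  | hinf =>
    induction w using sumSpace_cases with
    | hinf => exact hr
    | h m y => exact closeUp_trans ho h0 hi (hc _ _ _ _)
  | h n x =>
    induction w using sumSpace_cases with
    | hinf => exact closeUp_trans ho h0 (hc _ _ _ _) hi'
    | h m y => exact hc _ _ _ _

/-- The self-map of a sum moving the point at infinity to `incl n (x n)`. -/
noncomputable def moveInfty (x : ∀ n, (G n).carrier) (n : ℕ) : SumSpace G → SumSpace G :=
  fun w => w.elim (incl n (x n)) fun z => z

theorem moveInfty_infty (x : ∀ n, (G n).carrier) (n : ℕ) : moveInfty x n ∞ = incl n (x n) := rfl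

theorem moveInfty_incl (x : ∀ n, (G n).carrier) (n m : ℕ) (y : (G m).carrier) :
    moveInfty x n (incl m y) = incl m y := rfl

theorem tendsto_moveInfty (x : ∀ n, (G n).carrier) (z : SumSpace G) :
    Tendsto (fun n => moveInfty x n z) atTop (𝓝 z) := by
  induction z using sumSpace_cases with
  | hinf => simp only [moveInfty_infty]; exact tendsto_incl x
  | h m y => simp only [moveInfty_incl]; exact tendsto_const_nhds

end Sum

end Gadget

theorem two_le_add_one {o : Ordinal} (h : o ≠ 0) : 2 ≤ o + 1 := by
  rw [← one_add_one_eq_two, ← succ_eq_add_one, ← succ_eq_add_one]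
  exact succ_le_succ (one_le_iff_ne_zero.2 h)

theorem exists_seq_add_one {mu : Ordinal.{0}} (h : mu % 2 = 0) (h0 : mu ≠ 0)
    (hc : mu.card ≤ Cardinal.aleph0) :
    ∃ o : ℕ → Ordinal.{0}, (∀ n, 2 ≤ o n) ∧ (∀ n, o n ≤ mu) ∧ (∀ n, ∃ ν, o n = ν + 1) ∧
      ∀ γ < mu, ∀ N, ∃ n, N < n ∧ γ < o n := by
  rcases Ordinal.zero_or_succ_or_isSuccLimit mu with rfl | ⟨ν, rfl⟩ | hl
  · exact absurd rfl h0
  · rw [succ_eq_add_one] at *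
    have hν : ν ≠ 0 := by
      rintro rfl
      rw [add_one_mod_two_of_even (Ordinal.zero_mod 2)] at h
      exact one_ne_zero h
    refine ⟨fun _ => ν + 1, fun _ => ?_, fun _ => le_rfl, fun _ => ⟨ν, rfl⟩,
      fun γ hγ N => ⟨N + 1, N.lt_succ_self, hγ⟩⟩
    exact two_le_add_one hν
  · have : Countable (Iio mu) := by
      rw [← Cardinal.mk_le_aleph0_iff, Cardinal.mk_Iio_ordinal]
      exact (Cardinal.lift_le.2 hc).trans_eq Cardinal.lift_aleph0
    have : Nonempty (Iio mu) := ⟨⟨0, pos_iff_ne_zero.2 h0⟩⟩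
    obtain ⟨e, he⟩ := exists_surjective_nat (Iio mu)
    refine ⟨fun n => (e n.unpair.1).1 + 1 + 1, fun n => ?_, fun n => ?_, fun n => ⟨_, rfl⟩, ?_⟩
    · exact two_le_add_one (by simp)
    · exact (hl.succ_lt (hl.succ_lt (e n.unpair.1).2)).le
    · intro γ hγ N
      obtain ⟨k, hk⟩ := he ⟨γ, hγ⟩
      refine ⟨Nat.pair k (N + 1), N.lt_succ_self.trans_le (Nat.right_le_pair _ _), ?_⟩
      simp only [Nat.unpair_pair, hk]
      exact (lt_add_one γ).trans (lt_add_one _)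

namespace Gadget

/-- The points `p` and `q` become related exactly at stage `o` of the close-up process, which is
the stage at which everything becomes related. -/
structure Joins (G : Gadget) (p q : G.carrier) (o : Ordinal) : Prop where
  isOpen : IsOpen {p}
  full : closeUp G.rel o = univ
  notMem : ∀ γ < o, (p, q) ∉ closeUp G.rel γ

/-- There are relation-preserving self-maps converging pointwise to the identity, whose images
are fully related at stage `mu` of the close-up process. -/
def Approximable (G : Gadget) (mu : Ordinal) : Prop :=
  ∃ g : ℕ → G.carrier → G.carrier, (∀ z, Tendsto (fun n => g n z) atTop (𝓝 z)) ∧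
    (∀ n z w, (z, w) ∈ G.rel → (g n z, g n w) ∈ G.rel) ∧
    ∀ n z w, (g n z, g n w) ∈ closeUp G.rel mu

section Chain

variable {G : ℕ → Gadget} {p q : ∀ n, (G n).carrier} {o : ℕ → Ordinal} {mu : Ordinal}

theorem eq_infty_of_mem_closeUp (hG : ∀ n, Joins (G n) (p n) (q n) (o n))
    (hcof : ∀ γ < mu, ∀ N, ∃ n, N < n ∧ γ < o n) (hmu : mu % 2 = 0) (h0 : mu ≠ 0) {γ : Ordinal}
    (hγ : γ ≤ mu) {z : SumSpace G} (hz : (z, ∞) ∈ closeUp (sum p q).rel γ) : z = ∞ := by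
  have hlt : ∀ γ < mu, ∀ z : SumSpace G, (z, ∞) ∈ closeUp (sum p q).rel γ → z = ∞ := by
    intro γ hγ z hz
    induction z using sumSpace_cases with
    | hinf => rfl
    | h m x =>
      obtain ⟨n, hmn, hn⟩ := hcof γ hγ m
      have := retract_mem_closeUp n hz
      rw [retract_of_lt p q hmn, retract_infty] at this
      exact absurd this ((hG n).notMem γ hn)
  rcases hγ.lt_or_eq with hγ | rfl
  · exact hlt γ hγ z hz
  rcases Ordinal.zero_or_succ_or_isSuccLimit γ with rfl | ⟨ν, rfl⟩ | hl
  · exact absurd rfl h0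
  · rw [succ_eq_add_one] at *
    have hν : ν % 2 ≠ 0 := by
      intro h1
      rw [add_one_mod_two_of_even h1] at hmu
      exact one_ne_zero hmu
    rw [closeUp_add_one_of_odd _ hν] at hz
    refine Relation.TransGen.head_induction_on (motive := fun z _ => z = ∞) hz
      (fun h => hlt ν (lt_add_one ν) _ h) ?_
    rintro z w hzw - rfl
    exact hlt ν (lt_add_one ν) _ hzw
  · obtain ⟨δ, hδ, hz⟩ := (mem_closeUp_limit hl).1 hz
    exact hlt δ hδ z hz

theorem approximable_chain (hG : ∀ n, Joins (G n) (p n) (q n) (o n)) (hle : ∀ n, o n ≤ mu)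
    (hcof : ∀ γ < mu, ∀ N, ∃ n, N < n ∧ γ < o n) (hmu : mu % 2 = 0) (h0 : mu ≠ 0) :
    Approximable (sum p q) mu := by
  have hinf : ∀ z : SumSpace G, (z, ∞) ∈ (sum p q).rel → z = ∞ := fun z hz =>
    eq_infty_of_mem_closeUp hG hcof hmu h0 (zero_le (a := mu)) (by rwa [closeUp_zero])
  have hfull : ∀ n, closeUp (G n).rel mu = univ := fun n =>
    univ_subset_iff.1 ((hG n).full ▸ closeUp_mono _ (hle n))
  have hc := incl_mem_closeUp_of_full (a := p) (q := q) hmu h0 hfull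
  refine ⟨moveInfty p, tendsto_moveInfty p, fun n z w hzw => ?_, fun n z w => ?_⟩
  · induction z using sumSpace_cases with
    | hinf =>
      rw [hinf w ((sum p q).symm_rel _ _ hzw)]
      exact (sum p q).refl_rel _
    | h m x =>
      induction w using sumSpace_cases with
      | hinf => exact absurd (hinf _ hzw) (coe_ne_infty _)
      | h k y => exact hzw
  · induction z using sumSpace_cases with
    | hinf =>
      induction w using sumSpace_cases with
      | hinf => exact hc _ _ _ _
      | h k y => exact hc _ _ _ _
    | h m x =>
      induction w using sumSpace_cases with
      | hinf => exact hc _ _ _ _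
      | h k y => exact hc _ _ _ _

theorem isOpen_singleton_incl {n : ℕ} {x : (G n).carrier} (h : IsOpen {x}) :
    IsOpen {(incl n x : SumSpace G)} := by
  simpa using (isOpenEmbedding_incl n).isOpenMap _ h

theorem joins_chain (hG : ∀ n, Joins (G n) (p n) (q n) (o n)) (hle : ∀ n, o n ≤ mu)
    (hcof : ∀ γ < mu, ∀ N, ∃ n, N < n ∧ γ < o n) (hmu : mu % 2 = 0) (h0 : mu ≠ 0) :
    Joins (sum p q) (incl 0 (p 0)) ∞ (mu + 1) where
  isOpen := isOpen_singleton_incl (hG 0).isOpen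
  full := by
    obtain ⟨g, hg, -, hgmu⟩ := approximable_chain hG hle hcof hmu h0
    rw [closeUp_add_one_of_even _ hmu, eq_univ_iff_forall]
    rintro ⟨z, w⟩
    exact mem_closure_of_tendsto ((hg z).prodMk_nhds (hg w))
      (Eventually.of_forall fun n => hgmu n z w)
  notMem γ hγ h := coe_ne_infty _
    (eq_infty_of_mem_closeUp hG hcof hmu h0 (lt_add_one_iff.1 hγ) h)

end Chain

theorem joins_star {G : Gadget} {p q : G.carrier} {mu : Ordinal} (hmu : mu % 2 = 0)
    (hG : Joins G p q (mu + 1)) :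
    Joins (sum (G := fun _ => G) (fun _ => q) fun _ => q) (incl (G := fun _ => G) 0 p)
      (incl (G := fun _ => G) 1 p) (mu + 1 + 1) where
  isOpen := isOpen_singleton_incl (G := fun _ => G) hG.isOpen
  full := by
    refine closeUp_star_eq_univ ?_ (by simp) fun _ => ?_
    · exact add_one_mod_two_of_odd (by rw [add_one_mod_two_of_even hmu]; exact one_ne_zero)
    · exact univ_subset_iff.1 (hG.full ▸ closeUp_subset_add_one _ _)
  notMem γ hγ h := by
    have h1 := closeUp_mono _ (lt_add_one_iff.1 hγ) h
    rw [closeUp_add_one_of_even _ hmu] at h1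
    have ho : ∀ n, IsOpen {(incl n p : SumSpace fun _ => G)} := fun n =>
      isOpen_singleton_incl (G := fun _ => G) hG.isOpen
    obtain ⟨⟨z, w⟩, ⟨hz, hw⟩, hzw⟩ := mem_closure_iff.1 h1 _ ((ho 0).prod (ho 1)) ⟨rfl, rfl⟩
    obtain rfl : z = incl (G := fun _ => G) 0 p := hz
    obtain rfl : w = incl (G := fun _ => G) 1 p := hw
    have := retract_mem_closeUp (G := fun _ => G) 0 hzw
    rw [retract_self, retract_of_gt _ _ one_pos] at this
    exact hG.notMem mu (lt_add_one mu) this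

/-- The path with three vertices. -/
noncomputable def path : Gadget where
  carrier := Fin 3
  toReal i := (i : ℝ) / 3
  continuous_toReal := continuous_of_discreteTopology
  injective_toReal i j h := by
    have : ((i : ℕ) : ℝ) = (j : ℕ) := by simpa using h
    exact Fin.ext (by exact_mod_cast this)
  toReal_mem i := by
    have : ((i : ℕ) : ℝ) ≤ 3 := by exact_mod_cast i.2.le
    exact ⟨by positivity, by rw [div_le_one (by norm_num)]; exact this⟩
  rel := {z | (z.1 : ℕ) ≤ z.2 + 1 ∧ (z.2 : ℕ) ≤ z.1 + 1}
  isClosed_rel := isClosed_discrete _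
  refl_rel x := by simp
  symm_rel x y h := ⟨h.2, h.1⟩

theorem joins_path : Joins path (0 : Fin 3) (2 : Fin 3) (1 + 1) where
  isOpen := isOpen_discrete ({0} : Set (Fin 3))
  full := by
    have h1 : (1 : Ordinal) % 2 ≠ 0 := by
      rw [Ordinal.mod_eq_of_lt one_lt_two]; exact one_ne_zero
    rw [closeUp_add_one_of_odd _ h1, eq_univ_iff_forall]
    rintro ⟨x, y⟩
    have hx : (x, (1 : Fin 3)) ∈ path.rel := by
      change Fin 3 at x
      change (x : ℕ) ≤ 1 + 1 ∧ 1 ≤ (x : ℕ) + 1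
      omega
    have hy : ((1 : Fin 3), y) ∈ path.rel := by
      change Fin 3 at y
      change 1 ≤ (y : ℕ) + 1 ∧ (y : ℕ) ≤ 1 + 1
      omega
    exact .tail (.single (subset_closeUp _ _ hx)) (subset_closeUp _ _ hy)
  notMem γ hγ h := by
    have h1 := closeUp_mono _ (lt_add_one_iff.1 hγ) h
    rw [← zero_add 1, closeUp_add_one_of_even _ (Ordinal.zero_mod 2), closeUp_zero,
      path.isClosed_rel.closure_eq] at h1
    have : 2 ≤ 0 + 1 := h1.2
    omega

theorem exists_joins (o : Ordinal) (h2 : 2 ≤ o) (hc : o.card ≤ Cardinal.aleph0)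
    (hs : ∃ ν, o = ν + 1) :
    ∃ (G : Gadget) (p q : G.carrier), Joins G p q o ∧
      (o % 2 = 1 → ∀ mu, o = mu + 1 → Approximable G mu) := by
  induction o using WellFoundedLT.induction with
  | ind o ih =>
  obtain ⟨ν, rfl⟩ := hs
  have hν0 : ν ≠ 0 := by
    rintro rfl
    rw [zero_add] at h2
    exact h2.not_gt one_lt_two
  have hνc : ν.card ≤ Cardinal.aleph0 := (Ordinal.card_le_card (lt_add_one ν).le).trans hc
  by_cases hν : ν % 2 = 0
  · obtain ⟨o, ho2, hle, hs, hcof⟩ := exists_seq_add_one hν hν0 hνc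
    choose G p q hG using fun n => ih (o n) ((hle n).trans_lt (lt_add_one ν)) (ho2 n)
      ((Ordinal.card_le_card (hle n)).trans hνc) (hs n)
    refine ⟨sum p q, _, _, joins_chain (fun n => (hG n).1) hle hcof hν hν0, fun _ mu hmu => ?_⟩
    obtain rfl : ν = mu := add_one_inj.1 hmu
    exact approximable_chain (fun n => (hG n).1) hle hcof hν hν0
  · have hodd : (ν + 1) % 2 ≠ 1 := by
      rw [add_one_mod_two_of_odd hν]; exact zero_ne_one
    rcases Ordinal.zero_or_succ_or_isSuccLimit ν with rfl | ⟨mu, rfl⟩ | hl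
    · exact absurd rfl hν0
    · rw [succ_eq_add_one] at *
      have hmu : mu % 2 = 0 := by_contra fun h => hν (add_one_mod_two_of_odd h)
      by_cases h0 : mu = 0
      · subst h0
        rw [zero_add] at *
        exact ⟨path, _, _, joins_path, fun h => absurd h hodd⟩
      · have h2 : 2 ≤ mu + 1 := two_le_add_one h0
        obtain ⟨G, p, q, hG, -⟩ := ih (mu + 1) (lt_add_one _) h2 hνc ⟨mu, rfl⟩
        exact ⟨_, _, _, joins_star hmu hG, fun h => absurd h hodd⟩
    · exact absurd (mod_two_of_isSuccLimit hl) hν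

/-- The gadget with a single point. -/
noncomputable def point : Gadget where
  carrier := Unit
  toReal _ := 0
  continuous_toReal := continuous_const
  injective_toReal _ _ _ := rfl
  toReal_mem _ := by simp
  rel := univ
  isClosed_rel := isClosed_univ
  refl_rel _ := trivial
  symm_rel _ _ _ := trivial

theorem exists_gadget (o : Ordinal) (h1 : 1 ≤ o) (hc : o.card ≤ Cardinal.aleph0) :
    ∃ G : Gadget, closeUp G.rel o = univ ∧ (∀ γ < o, 1 ≤ γ → closeUp G.rel γ ≠ univ) ∧
      (2 < o → o % 2 = 1 → ∀ mu, o = mu + 1 → Approximable G mu) := by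
  rcases Ordinal.zero_or_succ_or_isSuccLimit o with rfl | ⟨ν, rfl⟩ | hl
  · simp at h1
  · rw [succ_eq_add_one] at *
    by_cases h0 : ν = 0
    · subst h0
      rw [zero_add] at *
      exact ⟨point, univ_subset_iff.1 (subset_closeUp _ _), fun γ h h' => absurd h h'.not_gt,
        fun h => absurd h one_lt_two.not_gt⟩
    · have h2 : 2 ≤ ν + 1 := two_le_add_one h0
      obtain ⟨G, p, q, hG, hA⟩ := exists_joins (ν + 1) h2 hc ⟨ν, rfl⟩
      exact ⟨G, hG.full, fun γ hγ _ h => hG.notMem γ hγ (h ▸ mem_univ _), fun _ => hA⟩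
  · have hev := mod_two_of_isSuccLimit hl
    have h0 : o ≠ 0 := one_le_iff_ne_zero.1 h1
    obtain ⟨s, hs2, hle, hs, hcof⟩ := exists_seq_add_one hev h0 hc
    choose G p q hG using fun n => exists_joins (s n) (hs2 n)
      ((Ordinal.card_le_card (hle n)).trans hc) (hs n)
    refine ⟨sum q q, closeUp_star_eq_univ hev h0 fun n => ?_, fun γ hγ _ h => ?_, fun _ h => ?_⟩
    · exact univ_subset_iff.1 ((hG n).1.full ▸ closeUp_mono _ (hle n))
    · obtain ⟨n, -, hn⟩ := hcof γ hγ 0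
      have h3 : ((incl n (p n) : SumSpace G), ∞) ∈ closeUp (sum q q).rel γ := h ▸ mem_univ _
      have h4 := retract_mem_closeUp n h3
      rw [retract_self, retract_infty] at h4
      exact (hG n).1.notMem γ hn h4
    · exact absurd (hev.symm.trans h) zero_ne_one

end Gadget

theorem pairSet_image_subset_closure {α β : Type*} [TopologicalSpace α] [TopologicalSpace β]
    {f : α → β} (hf : Continuous f) (hinj : Function.Injective f) {E F : Set (α × α)}
    {g : ℕ → α → α} (hg : ∀ z, Tendsto (fun n => g n z) atTop (𝓝 z))
    (hE : ∀ n z w, (z, w) ∈ E → (g n z, g n w) ∈ E) (hF : ∀ n z w, (g n z, g n w) ∈ F) (k : ℕ) :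
    pairSet (Prod.map f f '' E) k ⊆
      closure (relPow (Prod.map f f '' F) (k + k) ∩ pairSet (Prod.map f f '' E) k) := by
  have lift : ∀ u ∈ relPow (Prod.map f f '' E) k, ∃ x ∈ relPow E k, f ∘ x = u := by
    intro u hu
    choose p hp hpu using fun i => hu i i
    have hx : ∀ i, f (p i).1 = u i := fun i => congrArg Prod.fst (hpu i)
    refine ⟨fun i => (p i).1, fun i j => ?_, funext hx⟩
    obtain ⟨⟨c, d⟩, hcd, heq⟩ := hu i j
    obtain rfl : c = (p i).1 := hinj ((congrArg Prod.fst heq).trans (hx i).symm)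
    obtain rfl : d = (p j).1 := hinj ((congrArg Prod.snd heq).trans (hx j).symm)
    exact hcd
  rintro _ ⟨u, hu, v, hv, rfl⟩
  obtain ⟨x, hx, rfl⟩ := lift u hu
  obtain ⟨y, hy, rfl⟩ := lift v hv
  have happ : ∀ h : α → α, Fin.append (f ∘ h ∘ x) (f ∘ h ∘ y) = f ∘ h ∘ Fin.append x y := by
    intro h
    ext i
    refine Fin.addCases (fun i => ?_) (fun i => ?_) i <;>
      simp only [Function.comp_apply, Fin.append_left, Fin.append_right]
  refine mem_closure_of_tendsto (b := atTop) (f := fun n => f ∘ g n ∘ Fin.append x y) ?_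
    (Eventually.of_forall fun n => ⟨fun i j => ⟨(g n _, g n _), hF n _ _, rfl⟩,
      f ∘ g n ∘ x, fun i j => ⟨(g n (x i), g n (x j)), hE n _ _ (hx i j), rfl⟩,
      f ∘ g n ∘ y, fun i j => ⟨(g n (y i), g n (y j)), hE n _ _ (hy i j), rfl⟩, (happ (g n)).symm⟩)
  have h := happ id
  simp only [Function.id_comp] at h
  rw [h]
  exact tendsto_pi_nhds.2 fun i => (hf.tendsto _).comp (hg _)

end CPE

open CPE in
/-- For every countable ordinal `λ ≥ 1` there is a closed countable `X ⊆ [0,1]` and an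
equalizing closed symmetric reflexive relation `E ⊆ X²` with close-up rank `λ`; moreover if
`λ > 2` is odd (residue `1` mod `2`, so a successor `μ + 1`), then for every `k ≥ 1`,
`(E^[k])² ⊆ closure ((E^(λ-1))^[2k] ∩ (E^[k])²)` (inside `X^{2k}`, identifying a pair of
`k`-tuples with a `2k`-tuple by concatenation). -/
theorem closeUpRank_realized_on_interval_with_odd_condition (lam : Ordinal) (hlam : 1 ≤ lam)
    (hcount : lam.card ≤ Cardinal.aleph0) :
    ∃ X : Set ℝ, X ⊆ Set.Icc 0 1 ∧ IsClosed X ∧ X.Countable ∧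
      ∃ E : Set (ℝ × ℝ), E ⊆ X ×ˢ X ∧ IsClosed E ∧
        (∀ x ∈ X, (x, x) ∈ E) ∧ (∀ p ∈ E, (p.2, p.1) ∈ E) ∧
        (∃ o : Ordinal, closeUp E o = X ×ˢ X) ∧ closeUpRank E = lam ∧
        (2 < lam → lam % 2 = 1 → ∀ mu : Ordinal, lam = mu + 1 → ∀ k : ℕ, 1 ≤ k →
          pairSet E k ⊆ closure (relPow (closeUp E mu) (k + k) ∩ pairSet E k)) := by
  obtain ⟨G, hfull, hlt, hA⟩ := Gadget.exists_gadget lam hlam hcount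
  have hf := G.continuous_toReal.isClosedEmbedding G.injective_toReal
  refine ⟨range G.toReal, range_subset_iff.2 G.toReal_mem, hf.isClosed_range,
    countable_range _, Prod.map G.toReal G.toReal '' G.rel, ?_,
    (hf.prodMap hf).isClosedMap _ G.isClosed_rel, ?_, ?_, ⟨lam, ?_⟩, ?_, ?_⟩
  · rintro _ ⟨⟨x, y⟩, -, rfl⟩
    exact ⟨mem_range_self x, mem_range_self y⟩
  · rintro _ ⟨x, rfl⟩
    exact ⟨(x, x), G.refl_rel x, rfl⟩
  · rintro _ ⟨⟨x, y⟩, h, rfl⟩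
    exact ⟨(y, x), G.symm_rel x y h, rfl⟩
  · rw [closeUp_image hf, hfull, image_univ, range_prodMap]
  · rw [closeUpRank_image hf, closeUpRank_eq hlam G.isClosed_rel hfull hlt]
  · intro h2 hodd mu hmu k _
    obtain ⟨g, hg, hE, hF⟩ := hA h2 hodd mu hmu
    rw [closeUp_image hf]
    exact pairSet_image_subset_closure hf.continuous hf.injective hg hE hF k
end

section
/- For any compact metrizable zero-dimensional space Z, there exists a finite alphabet A, a subshift X ⊆ A^ℤ every point of which generates a Toeplitz subshift with zero entropy, and a continuous open surjection φ : X → Z with φ ∘ σ = φ such that φ⁻¹(z) is a minimal subshift for every z ∈ Z, and the map z ↦ φ⁻¹(z) is a homeomorphism from Z onto the space of minimal subshifts of X (with the topology induced by Hausdorff distance on closed subsets of X). -/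
open Filter Topology Set

namespace CPE

section Valuation

theorem padicValInt_two_eq_of_dvd_of_not_dvd {n : ℤ} {j : ℕ} (h : (2 : ℤ) ^ j ∣ n)
    (h' : ¬ (2 : ℤ) ^ (j + 1) ∣ n) : padicValInt 2 n = j := by
  have hn : n ≠ 0 := by rintro rfl; exact h' (dvd_zero _)
  have key := fun k => padicValInt_dvd_iff (p := 2) k n
  push_cast at key
  have h1 := ((key _).1 h).resolve_left hn
  have h2 := mt (fun h3 => (key (j + 1)).2 (Or.inr h3)) h'
  omega

theorem padicValInt_two_lt_of_not_dvd {n : ℤ} {k : ℕ} (h : ¬ (2 : ℤ) ^ k ∣ n) :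
    padicValInt 2 n < k := by
  by_contra! hk
  refine h ?_
  have := (padicValInt_dvd_iff (p := 2) k n).2 (Or.inr hk)
  exact_mod_cast this

theorem padicValInt_two_congr {m n : ℤ} {k : ℕ} (h : (2 : ℤ) ^ k ∣ m - n)
    (hn : ¬ (2 : ℤ) ^ k ∣ n) : padicValInt 2 m = padicValInt 2 n := by
  have hlt := padicValInt_two_lt_of_not_dvd hn
  have hn0 : n ≠ 0 := by rintro rfl; exact hn (dvd_zero _)
  have key : ∀ l ≤ k, ((2 : ℤ) ^ l ∣ m ↔ (2 : ℤ) ^ l ∣ n) := fun l hl =>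
    dvd_iff_dvd_of_dvd_sub ((pow_dvd_pow _ hl).trans h)
  refine padicValInt_two_eq_of_dvd_of_not_dvd ((key _ hlt.le).2 ?_) ?_
  · exact_mod_cast padicValInt_dvd (p := 2) n
  · rw [key _ hlt]
    intro hd
    have := (padicValInt_dvd_iff (p := 2) (padicValInt 2 n + 1) n).1 (by exact_mod_cast hd)
    omega

theorem not_two_pow_succ_dvd_two_pow (l : ℕ) : ¬ (2 : ℤ) ^ (l + 1) ∣ 2 ^ l := fun h => by
  have := Int.le_of_dvd (by positivity) h
  rw [pow_succ] at this
  have : (0 : ℤ) < 2 ^ l := by positivity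
  omega

theorem padicValInt_two_two_pow (l : ℕ) : padicValInt 2 (2 ^ l) = l :=
  padicValInt_two_eq_of_dvd_of_not_dvd dvd_rfl (not_two_pow_succ_dvd_two_pow l)

end Valuation

section Shift

variable {α : Type*}

theorem shiftZ_add (m n : ℤ) (x : ℤ → α) : shiftZ (m + n) x = shiftZ m (shiftZ n x) := by
  funext i
  simp only [shiftZ]
  congr 1
  ring

theorem shiftZ_zero (x : ℤ → α) : shiftZ 0 x = x := by
  funext i
  simp [shiftZ]

theorem shiftZ_one (x : ℤ → α) : shiftZ 1 x = shiftMap x := rfl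

variable [TopologicalSpace α]

theorem isSubshift_of_forall_shiftZ_mem {X : Set (ℤ → α)} (hX : IsClosed X)
    (h : ∀ m, ∀ x ∈ X, shiftZ m x ∈ X) : IsSubshift X := by
  refine ⟨hX, Subset.antisymm ?_ fun x hx => ⟨shiftZ (-1) x, h _ _ hx, ?_⟩⟩
  · rintro _ ⟨x, hx, rfl⟩
    exact h 1 x hx
  · rw [← shiftZ_one, ← shiftZ_add, add_neg_cancel, shiftZ_zero]

theorem IsSubshift.shiftZ_mem {X : Set (ℤ → α)} (hX : IsSubshift X) {x : ℤ → α} (hx : x ∈ X)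
    (m : ℤ) : shiftZ m x ∈ X := by
  induction m using Int.induction_on with
  | zero => rwa [shiftZ_zero]
  | succ n ih =>
    rw [add_comm, shiftZ_add, shiftZ_one, ← hX.2]
    exact mem_image_of_mem _ ih
  | pred n ih =>
    rw [← hX.2] at ih
    obtain ⟨y, hy, hyx⟩ := ih
    rw [sub_eq_neg_add, shiftZ_add, ← hyx, ← shiftZ_one, ← shiftZ_add, neg_add_cancel,
      shiftZ_zero]
    exact hy

theorem IsSubshift.orbitClosure_subset {X : Set (ℤ → α)} (hX : IsSubshift X) {x : ℤ → α}
    (hx : x ∈ X) : orbitClosure x ⊆ X :=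
  closure_minimal (by rintro _ ⟨m, rfl⟩; exact hX.shiftZ_mem hx m) hX.1

theorem exists_window_subset [DiscreteTopology α] {U : Set (ℤ → α)} (hU : IsOpen U)
    {y : ℤ → α} (hy : y ∈ U) :
    ∃ N : ℕ, ∀ x : ℤ → α, (∀ i, -(N : ℤ) ≤ i → i ≤ N → x i = y i) → x ∈ U := by
  obtain ⟨I, u, hu, hIU⟩ := isOpen_pi_iff.1 hU y hy
  refine ⟨I.sup Int.natAbs, fun x hx => hIU fun i hi => ?_⟩
  have : i.natAbs ≤ I.sup Int.natAbs := Finset.le_sup (f := Int.natAbs) hi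
  rw [hx i (by omega) (by omega)]
  exact (hu i hi).2

end Shift

section Skeleton

variable {α : Type*}

/-- Outside one residue class modulo `2 ^ k`, the point `x` reads the letter `w l` at the
positions whose translate by `a` has `2`-adic valuation `l`. -/
def IsSkeleton (w : ℕ → α) (k : ℕ) (a : ℤ) (x : ℤ → α) : Prop :=
  ∀ i : ℤ, ¬ (2 : ℤ) ^ k ∣ i + a → x i = w (padicValInt 2 (i + a))

/-- The points which, at every scale `2 ^ k`, follow the Toeplitz pattern coded by `w`. -/
def toeplitzShift (w : ℕ → α) : Set (ℤ → α) :=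
  {x | ∀ k, ∃ a, IsSkeleton w k a x}

/-- Every letter occurs in every block of three consecutive terms of `w`. -/
def HasBoundedGaps (w : ℕ → α) : Prop :=
  ∀ j c, ∃ l, j ≤ l ∧ l < j + 3 ∧ w l = c

theorem IsSkeleton.shiftZ {w : ℕ → α} {k : ℕ} {a : ℤ} {x : ℤ → α} (h : IsSkeleton w k a x)
    (m : ℤ) : IsSkeleton w k (a + m) (shiftZ m x) := fun i hi => by
  have e : i + (a + m) = i + m + a := by ring
  rw [e] at hi ⊢
  exact h _ hi

theorem IsSkeleton.congr_right {w : ℕ → α} {k : ℕ} {a b : ℤ} {x : ℤ → α}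
    (h : IsSkeleton w k a x) (hab : (2 : ℤ) ^ k ∣ b - a) : IsSkeleton w k b x := fun i hi => by
  have hd : (2 : ℤ) ^ k ∣ (i + b) - (i + a) := by simpa using hab
  have hi' : ¬ (2 : ℤ) ^ k ∣ i + a := fun h' => hi ((dvd_iff_dvd_of_dvd_sub hd).2 h')
  rw [h i hi', padicValInt_two_congr hd hi']

theorem IsSkeleton.exists_lt {w : ℕ → α} {k : ℕ} {a : ℤ} {x : ℤ → α} (h : IsSkeleton w k a x) :
    ∃ b : ℕ, b < 2 ^ k ∧ IsSkeleton w k b x := by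
  have hpos : (0 : ℤ) < 2 ^ k := by positivity
  have h0 := Int.emod_nonneg a hpos.ne'
  have h1 := Int.emod_lt_of_pos a hpos
  refine ⟨(a % 2 ^ k).toNat, ?_, h.congr_right ?_⟩
  · zify
    rwa [Int.toNat_of_nonneg h0]
  · rw [Int.toNat_of_nonneg h0]
    exact (Int.mod_modEq a (2 ^ k)).symm.dvd

theorem shiftZ_mem_toeplitzShift {w : ℕ → α} (m : ℤ) {x : ℤ → α} (hx : x ∈ toeplitzShift w) :
    shiftZ m x ∈ toeplitzShift w := fun k =>
  let ⟨a, ha⟩ := hx k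
  ⟨a + m, ha.shiftZ m⟩

theorem IsSkeleton.two_pow_dvd_sub [Nontrivial α] {w w' : ℕ → α} {k : ℕ} {a a' : ℤ} {x : ℤ → α}
    (hw' : HasBoundedGaps w') (h : IsSkeleton w k a x) (h' : IsSkeleton w' k a' x) {j : ℕ}
    (hj : j + 3 ≤ k) : (2 : ℤ) ^ j ∣ a - a' := by
  induction j with
  | zero => simp
  | succ j ih =>
    have ih := ih (by omega)
    by_contra hd
    obtain ⟨c, hc⟩ := exists_ne (w j)
    obtain ⟨l, hl, hl', hlc⟩ := hw' (j + 1) c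
    have e' : 2 ^ l - a' + a' = 2 ^ l := by ring
    have e : 2 ^ l - a' + a - (a - a') = 2 ^ l := by ring
    have hdl : (2 : ℤ) ^ (j + 1) ∣ 2 ^ l - a' + a - (a - a') := by
      rw [e]
      exact pow_dvd_pow _ hl
    have h1 := h' (2 ^ l - a') (by
      rw [e']
      exact fun h3 => not_two_pow_succ_dvd_two_pow l ((pow_dvd_pow _ (by omega)).trans h3))
    have h2 := h (2 ^ l - a') fun h3 =>
      hd ((dvd_iff_dvd_of_dvd_sub hdl).1 ((pow_dvd_pow _ (by omega)).trans h3))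
    rw [e', padicValInt_two_two_pow] at h1
    rw [padicValInt_two_congr hdl hd, padicValInt_two_eq_of_dvd_of_not_dvd ih hd] at h2
    exact hc (by rw [← hlc, ← h1, h2])

theorem eq_of_mem_toeplitzShift [Nontrivial α] {w w' : ℕ → α} (hw' : HasBoundedGaps w')
    {x : ℤ → α} (h : x ∈ toeplitzShift w) (h' : x ∈ toeplitzShift w') : w = w' := by
  funext j
  obtain ⟨a, ha⟩ := h (j + 4)
  obtain ⟨a', ha'⟩ := h' (j + 4)
  have hd := ha.two_pow_dvd_sub hw' ha' (j := j + 1) (by omega)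
  have e : (2 : ℤ) ^ j - a + a = 2 ^ j := by ring
  have hj : ¬ (2 : ℤ) ^ (j + 1) ∣ 2 ^ j - a + a := by
    rw [e]
    exact not_two_pow_succ_dvd_two_pow j
  have hda : (2 : ℤ) ^ (j + 1) ∣ 2 ^ j - a + a' - (2 ^ j - a + a) := by
    rw [add_sub_add_left_eq_sub]
    exact (dvd_sub_comm).1 hd
  have hj' : ¬ (2 : ℤ) ^ (j + 1) ∣ 2 ^ j - a + a' := mt (dvd_iff_dvd_of_dvd_sub hda).1 hj
  have h1 := ha _ fun h3 => hj ((pow_dvd_pow _ (by omega)).trans h3)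
  have h2 := ha' (2 ^ j - a) fun h3 => hj' ((pow_dvd_pow _ (by omega)).trans h3)
  rw [padicValInt_two_congr hda hj, e, padicValInt_two_two_pow] at h2
  rw [e, padicValInt_two_two_pow] at h1
  rw [← h1, h2]

theorem IsSkeleton.exists_shiftZ_eq {w w' : ℕ → α} {k : ℕ} {a : ℤ} {x y : ℤ → α}
    (hy : IsSkeleton w k a y) (hww' : ∀ l < k, w' l = w l) (hw' : HasBoundedGaps w')
    (hx : x ∈ toeplitzShift w') (N : ℤ) :
    ∃ m, ∀ i, N ≤ i → i < N + 2 ^ k → CPE.shiftZ m x i = y i := by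
  have hpos : (0 : ℤ) < 2 ^ k := by positivity
  obtain ⟨p, hNp, hpN, hp⟩ : ∃ p, N ≤ p ∧ p < N + 2 ^ k ∧ (2 : ℤ) ^ k ∣ p + a := by
    refine ⟨N + (-a - N) % 2 ^ k, ?_, ?_, ?_⟩
    · have := Int.emod_nonneg (-a - N) hpos.ne'
      omega
    · have := Int.emod_lt_of_pos (-a - N) hpos
      omega
    · have := (Int.mod_modEq (-a - N) (2 ^ k)).symm.dvd
      convert this using 1
      ring
  obtain ⟨l, hkl, -, hl⟩ := hw' k (y p)
  obtain ⟨b, hb⟩ := hx (l + 1)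
  refine ⟨2 ^ l - b - p, fun i hi hi' => ?_⟩
  have hb := hb (i + (2 ^ l - b - p))
  have e : i + (2 ^ l - b - p) + b = i - p + 2 ^ l := by ring
  rw [e] at hb
  rcases eq_or_ne i p with rfl | hip
  · rw [sub_self, zero_add, padicValInt_two_two_pow, hl] at hb
    exact hb (not_two_pow_succ_dvd_two_pow l)
  · have hnd : ¬ (2 : ℤ) ^ k ∣ i - p := fun h =>
      hip (sub_eq_zero.1 (Int.eq_zero_of_abs_lt_dvd h (abs_lt.2 ⟨by omega, by omega⟩)))
    have hd : (2 : ℤ) ^ k ∣ i - p + 2 ^ l - (i - p) := by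
      rw [add_sub_cancel_left]
      exact pow_dvd_pow _ hkl
    have hd' : (2 : ℤ) ^ k ∣ i + a - (i - p) := by
      convert hp using 1
      ring
    have h1 := hb fun h => hnd ((dvd_iff_dvd_of_dvd_sub hd).1
      ((pow_dvd_pow _ (by omega)).trans h))
    have h2 := hy i fun h => hnd ((dvd_iff_dvd_of_dvd_sub hd').1 h)
    rw [padicValInt_two_congr hd hnd] at h1
    rw [padicValInt_two_congr hd' hnd] at h2
    rw [h2, ← hww' _ (padicValInt_two_lt_of_not_dvd hnd)]
    exact h1

/-- The Toeplitz point of `toeplitzShift w` attached to the `2`-adic integer `-1 / 3`. -/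
def toeplitzPoint (w : ℕ → α) (i : ℤ) : α := w (padicValInt 2 (3 * i - 1))

theorem isToeplitz_toeplitzPoint (w : ℕ → α) : IsToeplitz (toeplitzPoint w) := fun i => by
  refine ⟨2 ^ (padicValInt 2 (3 * i - 1) + 1), by positivity, fun m => ?_⟩
  unfold toeplitzPoint
  congr 1
  refine padicValInt_two_congr (k := padicValInt 2 (3 * i - 1) + 1)
    ⟨3 * m, by push_cast; ring⟩ fun h => ?_
  have := (padicValInt_dvd_iff (p := 2) _ _).1 (by exact_mod_cast h)
  omega

theorem toeplitzPoint_mem (w : ℕ → α) : toeplitzPoint w ∈ toeplitzShift w := fun k => by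
  have h3 : IsCoprime (2 ^ k : ℤ) 3 := IsCoprime.pow_left (by norm_num)
  obtain ⟨u, v, huv⟩ := h3
  -- `-v` is a multiplicative inverse of `-3` modulo `2 ^ k`
  refine ⟨-v, fun i hi => ?_⟩
  have e : (2 : ℤ) ^ k ∣ 3 * i - 1 - 3 * (i + -v) := ⟨-u, by linarith⟩
  have hd : ∀ j, (2 : ℤ) ^ j ∣ 3 * (i + -v) ↔ (2 : ℤ) ^ j ∣ i + -v := fun j =>
    ⟨(IsCoprime.pow_left (by norm_num) : IsCoprime (2 ^ j : ℤ) 3).dvd_of_dvd_mul_left,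
      fun h => h.mul_left 3⟩
  unfold toeplitzPoint
  rw [padicValInt_two_congr e (mt (hd k).1 hi)]
  congr 1
  refine padicValInt_two_eq_of_dvd_of_not_dvd ((hd _).2 ?_) (mt (hd _).1 fun h => ?_)
  · exact_mod_cast padicValInt_dvd (p := 2) (i + -v)
  · have h0 : i + -v ≠ 0 := by intro h0; rw [h0] at hi; exact hi (dvd_zero _)
    have := (padicValInt_dvd_iff (p := 2) _ _).1 (by exact_mod_cast h)
    omega

section Index

variable {Z : Type*} {w : Z → ℕ → α}

/-- The index of the member of the family `toeplitzShift (w z)` in which a point lies. -/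
noncomputable def toeplitzIndex (w : Z → ℕ → α) (x : ⋃ z, toeplitzShift (w z)) : Z :=
  (mem_iUnion.1 x.2).choose

theorem toeplitzIndex_eq_iff [Nontrivial α] (hinj : Function.Injective w)
    (hgap : ∀ z, HasBoundedGaps (w z))
    {x : ⋃ z, toeplitzShift (w z)} {z : Z} :
    toeplitzIndex w x = z ↔ (x : ℤ → α) ∈ toeplitzShift (w z) := by
  have h := (mem_iUnion.1 x.2).choose_spec
  refine ⟨?_, fun hz => hinj (eq_of_mem_toeplitzShift (hgap z) h hz)⟩
  rintro rfl
  exact h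

theorem image_toeplitzIndex_preimage [Nontrivial α] (hinj : Function.Injective w)
    (hgap : ∀ z, HasBoundedGaps (w z)) (z : Z) :
    Subtype.val '' (toeplitzIndex w ⁻¹' {z}) = toeplitzShift (w z) := by
  ext x
  constructor
  · rintro ⟨y, hy, rfl⟩
    exact (toeplitzIndex_eq_iff hinj hgap).1 hy
  · intro hx
    exact ⟨⟨x, mem_iUnion.2 ⟨z, hx⟩⟩, (toeplitzIndex_eq_iff hinj hgap).2 hx, rfl⟩

end Index

end Skeleton

section Topology

variable {α : Type*} [TopologicalSpace α] [DiscreteTopology α]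

theorem isClosed_setOf_mem_toeplitzShift {Z : Type*} [TopologicalSpace Z] {w : Z → ℕ → α}
    (hw : Continuous w) : IsClosed {p : (ℤ → α) × Z | p.1 ∈ toeplitzShift (w p.2)} := by
  have : {p : (ℤ → α) × Z | p.1 ∈ toeplitzShift (w p.2)} =
      ⋂ k : ℕ, ⋃ a ∈ Finset.range (2 ^ k), {p | IsSkeleton (w p.2) k (a : ℤ) p.1} := by
    ext p
    simp only [mem_ofPred_eq, toeplitzShift, mem_iInter, mem_iUnion, Finset.mem_range]
    refine forall_congr' fun k => ⟨fun ⟨a, ha⟩ => ?_, fun ⟨a, _, ha⟩ => ⟨a, ha⟩⟩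
    obtain ⟨b, hb, hb'⟩ := ha.exists_lt
    exact ⟨b, hb, hb'⟩
  rw [this]
  refine isClosed_iInter fun k => isClosed_biUnion_finset fun a _ => ?_
  simp only [IsSkeleton, ofPred_forall]
  refine isClosed_iInter fun i => isClosed_iInter fun _ => ?_
  exact isClosed_eq ((continuous_apply i).comp continuous_fst)
    ((continuous_apply _).comp (hw.comp continuous_snd))

theorem isClosed_toeplitzShift (w : ℕ → α) : IsClosed (toeplitzShift w) :=
  (isClosed_setOf_mem_toeplitzShift (Z := Unit) (w := fun _ => w) continuous_const).preimage
    (f := fun x => (x, ())) (by fun_prop)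

theorem isSubshift_toeplitzShift (w : ℕ → α) : IsSubshift (toeplitzShift w) :=
  isSubshift_of_forall_shiftZ_mem (isClosed_toeplitzShift w)
    fun m _ => shiftZ_mem_toeplitzShift m

/-- Shifts of a point of `toeplitzShift w'` approximate every point of `toeplitzShift w`,
provided that `w` and `w'` agree on a long initial segment. -/
theorem exists_forall_shiftZ_mem {w : ℕ → α} {y : ℤ → α} (hy : y ∈ toeplitzShift w)
    {U : Set (ℤ → α)} (hU : IsOpen U) (hyU : y ∈ U) :
    ∃ k : ℕ, ∀ w' : ℕ → α, HasBoundedGaps w' → (∀ l < k, w' l = w l) →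
      ∀ x ∈ toeplitzShift w', ∃ m, shiftZ m x ∈ U := by
  obtain ⟨N, hN⟩ := exists_window_subset hU hyU
  obtain ⟨a, ha⟩ := hy (2 * N + 1)
  refine ⟨2 * N + 1, fun w' hw' hww' x hx => ?_⟩
  obtain ⟨m, hm⟩ := ha.exists_shiftZ_eq hww' hw' hx (-N)
  refine ⟨m, hN _ fun i hi hi' => hm i hi ?_⟩
  have : ((2 * N + 1 : ℕ) : ℤ) < 2 ^ (2 * N + 1) := by
    exact_mod_cast Nat.lt_two_pow_self
  push_cast at this
  omega

theorem orbitClosure_eq_toeplitzShift {w : ℕ → α} (hw : HasBoundedGaps w) {x : ℤ → α}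
    (hx : x ∈ toeplitzShift w) : orbitClosure x = toeplitzShift w := by
  refine Subset.antisymm ((isSubshift_toeplitzShift w).orbitClosure_subset hx) fun y hy => ?_
  refine mem_closure_iff.2 fun U hU hyU => ?_
  obtain ⟨k, hk⟩ := exists_forall_shiftZ_mem hy hU hyU
  obtain ⟨m, hm⟩ := hk w hw (fun _ _ => rfl) x hx
  exact ⟨_, hm, m, rfl⟩

theorem isMinimalSubshift_toeplitzShift {w : ℕ → α} (hw : HasBoundedGaps w) :
    IsMinimalSubshift (toeplitzShift w) := by
  refine ⟨isSubshift_toeplitzShift w, ⟨_, toeplitzPoint_mem w⟩, fun M hM hMs ⟨x, hx⟩ => ?_⟩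
  refine hM.antisymm ?_
  rw [← orbitClosure_eq_toeplitzShift hw (hM hx)]
  exact hMs.orbitClosure_subset hx

end Topology

section Entropy

variable {α : Type*} [Finite α]

theorem ncard_lang_toeplitzShift_le (w : ℕ → α) {n k : ℕ} (hnk : n ≤ 2 ^ k) :
    (lang (toeplitzShift w) n).ncard ≤ 2 ^ k * Nat.card α := by
  classical
  let f : Fin (2 ^ k) × α → Fin n → α := fun p i =>
    if (2 : ℤ) ^ k ∣ (i : ℤ) + p.1 then p.2 else w (padicValInt 2 ((i : ℤ) + p.1))
  have hsub : lang (toeplitzShift w) n ⊆ range f := by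
    rintro u ⟨x, hx, hxu⟩
    obtain ⟨a, ha⟩ := hx k
    obtain ⟨b, hb, hbx⟩ := ha.exists_lt
    have hf : ∀ c, (∀ i : Fin n, (2 : ℤ) ^ k ∣ (i : ℤ) + b → u i = c) →
        f (⟨b, hb⟩, c) = u := fun c hc => by
      funext i
      by_cases hi : (2 : ℤ) ^ k ∣ (i : ℤ) + b
      · simp [f, hi, hc i hi]
      · simp [f, hi, ← hxu, hbx i hi]
    by_cases hp : ∃ p : Fin n, (2 : ℤ) ^ k ∣ (p : ℤ) + b
    · obtain ⟨p, hp⟩ := hp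
      refine ⟨_, hf (u p) fun i hi => ?_⟩
      congr 1
      have hd : (2 : ℤ) ^ k ∣ (i : ℤ) - p := by
        simpa using dvd_sub hi hp
      have hi2 := i.2
      have hp2 := p.2
      zify at hnk hi2 hp2
      have := Int.eq_zero_of_abs_lt_dvd hd (abs_lt.2 ⟨by omega, by omega⟩)
      exact Fin.ext (by omega)
    · exact ⟨_, hf (x 0) fun i hi => (hp ⟨i, hi⟩).elim⟩
  calc (lang (toeplitzShift w) n).ncard ≤ (range f).ncard := ncard_le_ncard hsub (toFinite _)
    _ ≤ Nat.card (Fin (2 ^ k) × α) := by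
        rw [← image_univ, ← ncard_univ]
        exact ncard_image_le (toFinite _)
    _ = 2 ^ k * Nat.card α := by simp

theorem hasZeroEntropy_toeplitzShift (w : ℕ → α) : HasZeroEntropy (toeplitzShift w) := by
  have hlim : Tendsto (fun n : ℕ => Real.log (2 * Nat.card α) / n + Real.log n / n) atTop
      (𝓝 0) := by
    have h1 : Tendsto (fun n : ℕ => Real.log n / n) atTop (𝓝 0) :=
      (Real.isLittleO_log_id_atTop.tendsto_div_nhds_zero).comp tendsto_natCast_atTop_atTop
    simpa using (tendsto_const_div_atTop_nhds_zero_nat (Real.log (2 * Nat.card α))).add h1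
  refine tendsto_of_tendsto_of_tendsto_of_le_of_le' tendsto_const_nhds hlim
    (Eventually.of_forall fun n => ?_) ?_
  · exact div_nonneg (Real.log_natCast_nonneg _) (Nat.cast_nonneg _)
  filter_upwards [eventually_gt_atTop 1] with n hn
  have hα : 0 < Nat.card α := Nat.card_pos_iff.2 ⟨⟨w 0⟩, inferInstance⟩
  rw [← add_div, ← Real.log_mul (by positivity) (by positivity)]
  refine div_le_div_of_nonneg_right ?_ (Nat.cast_nonneg _)
  have hpow : 2 ^ Nat.clog 2 n ≤ 2 * n := by
    have h1 := Nat.pow_pred_clog_lt_self one_lt_two hn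
    have h2 := Nat.clog_pos one_lt_two hn
    calc 2 ^ Nat.clog 2 n = 2 * 2 ^ (Nat.clog 2 n).pred := by
          rw [← pow_succ', Nat.pred_eq_sub_one, Nat.sub_add_cancel h2]
      _ ≤ 2 * n := by omega
  have hle : (lang (toeplitzShift w) n).ncard ≤ 2 * Nat.card α * n :=
    calc (lang (toeplitzShift w) n).ncard ≤ 2 ^ Nat.clog 2 n * Nat.card α :=
          ncard_lang_toeplitzShift_le w (Nat.le_pow_clog one_lt_two n)
      _ ≤ 2 * n * Nat.card α := Nat.mul_le_mul_right _ hpow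
      _ = 2 * Nat.card α * n := by ring
  rcases Nat.eq_zero_or_pos (lang (toeplitzShift w) n).ncard with h0 | h0
  · rw [h0, Nat.cast_zero, Real.log_zero]
    exact_mod_cast Real.log_natCast_nonneg (2 * Nat.card α * n)
  · exact Real.log_le_log (by exact_mod_cast h0) (by exact_mod_cast hle)

end Entropy

section Family

variable {α : Type*} [TopologicalSpace α] [DiscreteTopology α]
  {Z : Type*} [TopologicalSpace Z] {w : Z → ℕ → α}

theorem isOpen_setOf_toeplitzShift_inter_nonempty (hw : Continuous w)
    (hgap : ∀ z, HasBoundedGaps (w z)) {U : Set (ℤ → α)} (hU : IsOpen U) :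
    IsOpen {z | (toeplitzShift (w z) ∩ U).Nonempty} := by
  refine isOpen_iff_mem_nhds.2 fun z ⟨y, hy, hyU⟩ => ?_
  obtain ⟨k, hk⟩ := exists_forall_shiftZ_mem hy hU hyU
  have hnhds : ∀ᶠ z' in 𝓝 z, ∀ l ∈ Finset.range k, w z' l = w z l := by
    refine (Finset.eventually_all _).2 fun l _ => ?_
    have hl : Continuous fun z' => w z' l := (continuous_apply l).comp hw
    exact hl.continuousAt (mem_nhds_discrete.2 (mem_singleton (w z l)))
  filter_upwards [hnhds] with z' hz'
  obtain ⟨m, hm⟩ := hk (w z') (hgap z') (fun l hl => hz' l (Finset.mem_range.2 hl)) _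
    (toeplitzPoint_mem (w z'))
  exact ⟨_, shiftZ_mem_toeplitzShift m (toeplitzPoint_mem (w z')), hm⟩

theorem isClosed_iUnion_toeplitzShift [CompactSpace Z] (hw : Continuous w) {C : Set Z}
    (hC : IsClosed C) : IsClosed (⋃ z ∈ C, toeplitzShift (w z)) := by
  have : ⋃ z ∈ C, toeplitzShift (w z) = Prod.fst ''
      ({p : (ℤ → α) × Z | p.1 ∈ toeplitzShift (w p.2)} ∩ Prod.snd ⁻¹' C) := by
    ext x
    simp [and_comm]
  rw [this]
  exact isClosedMap_fst_of_compactSpace _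
    ((isClosed_setOf_mem_toeplitzShift hw).inter (hC.preimage continuous_snd))

theorem isSubshift_iUnion_toeplitzShift [CompactSpace Z] (hw : Continuous w) :
    IsSubshift (⋃ z, toeplitzShift (w z)) := by
  refine isSubshift_of_forall_shiftZ_mem ?_ fun m x hx => ?_
  · simpa using isClosed_iUnion_toeplitzShift hw isClosed_univ
  · obtain ⟨z, hz⟩ := mem_iUnion.1 hx
    exact mem_iUnion.2 ⟨z, shiftZ_mem_toeplitzShift m hz⟩

theorem continuous_toeplitzIndex [Nontrivial α] [CompactSpace Z] (hw : Continuous w)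
    (hinj : Function.Injective w) (hgap : ∀ z, HasBoundedGaps (w z)) :
    Continuous (toeplitzIndex w) := by
  refine continuous_iff_isClosed.2 fun C hC => ?_
  convert (isClosed_iUnion_toeplitzShift hw hC).preimage continuous_subtype_val using 1
  ext x
  simp only [mem_preimage, mem_iUnion, ← toeplitzIndex_eq_iff hinj hgap, exists_prop,
    exists_eq_right']

theorem isOpenMap_toeplitzIndex [Nontrivial α] (hw : Continuous w) (hinj : Function.Injective w)
    (hgap : ∀ z, HasBoundedGaps (w z)) : IsOpenMap (toeplitzIndex w) := by
  rintro _ ⟨V, hV, rfl⟩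
  convert isOpen_setOf_toeplitzShift_inter_nonempty hw hgap hV using 1
  ext z
  constructor
  · rintro ⟨x, hx, hxz⟩
    exact ⟨x, (toeplitzIndex_eq_iff hinj hgap).1 hxz, hx⟩
  · rintro ⟨x, hx, hxV⟩
    exact ⟨⟨x, mem_iUnion.2 ⟨z, hx⟩⟩, hxV, (toeplitzIndex_eq_iff hinj hgap).2 hx⟩

/-- `toeplitzShift w` as a nonempty compact set. -/
def toeplitzCompacts [Finite α] (w : ℕ → α) : TopologicalSpace.NonemptyCompacts (ℤ → α) where
  carrier := toeplitzShift w
  isCompact' := (isClosed_toeplitzShift w).isCompact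
  nonempty' := ⟨_, toeplitzPoint_mem w⟩

theorem continuous_toeplitzCompacts [Finite α] [CompactSpace Z] (hw : Continuous w)
    (hgap : ∀ z, HasBoundedGaps (w z)) : Continuous fun z => toeplitzCompacts (w z) := by
  let _ := TopologicalSpace.vietoris (ℤ → α)
  refine TopologicalSpace.NonemptyCompacts.isEmbedding_coe.continuous_iff.2 ?_
  refine TopologicalSpace.vietoris.continuous_iff.2 ⟨fun U hU => ?_, fun F hF => ?_⟩
  · rw [← isClosed_compl_iff]
    convert isClosedMap_snd_of_compactSpace _
      ((isClosed_setOf_mem_toeplitzShift hw).inter (hU.isClosed_compl.preimage continuous_fst))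
      using 1
    ext z
    change ¬ toeplitzShift (w z) ⊆ U ↔ _
    simp [not_subset]
  · rw [← isOpen_compl_iff]
    convert isOpen_setOf_toeplitzShift_inter_nonempty hw hgap hF.isOpen_compl using 1
    ext z
    change ¬ toeplitzShift (w z) ⊆ F ↔ _
    exact not_subset

theorem exists_homeomorph_minimalSubshifts [Nontrivial α] [Finite α] [CompactSpace Z]
    (hw : Continuous w)
    (hinj : Function.Injective w) (hgap : ∀ z, HasBoundedGaps (w z)) :
    ∃ e : Z ≃ₜ {M : TopologicalSpace.NonemptyCompacts (ℤ → α) //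
        (M : Set (ℤ → α)) ⊆ ⋃ z, toeplitzShift (w z) ∧ IsMinimalSubshift (M : Set (ℤ → α))},
      ∀ z, ((e z : TopologicalSpace.NonemptyCompacts (ℤ → α)) : Set (ℤ → α)) =
        toeplitzShift (w z) := by
  let f : Z → {M : TopologicalSpace.NonemptyCompacts (ℤ → α) //
      (M : Set (ℤ → α)) ⊆ ⋃ z, toeplitzShift (w z) ∧ IsMinimalSubshift (M : Set (ℤ → α))} :=
    fun z => ⟨toeplitzCompacts (w z), subset_iUnion (fun z => toeplitzShift (w z)) z,
      isMinimalSubshift_toeplitzShift (hgap z)⟩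
  have hf : Continuous f := (continuous_toeplitzCompacts hw hgap).subtype_mk _
  have hbij : Function.Bijective f := by
    constructor
    · intro z z' h
      have h : toeplitzShift (w z) = toeplitzShift (w z') :=
        congrArg (fun M => ((M : TopologicalSpace.NonemptyCompacts (ℤ → α)) : Set (ℤ → α)))
          (congrArg Subtype.val h)
      exact hinj (eq_of_mem_toeplitzShift (hgap z') (toeplitzPoint_mem (w z))
        (h ▸ toeplitzPoint_mem (w z)))
    · rintro ⟨M, hMX, hM⟩
      obtain ⟨x, hx⟩ := M.nonempty
      obtain ⟨z, hz⟩ := mem_iUnion.1 (hMX hx)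
      refine ⟨z, Subtype.ext (SetLike.coe_injective ?_)⟩
      refine hM.2.2 _ ?_ (isSubshift_toeplitzShift (w z)) ⟨_, toeplitzPoint_mem (w z)⟩
      change toeplitzShift (w z) ⊆ M
      rw [← orbitClosure_eq_toeplitzShift (hgap z) hz]
      exact hM.1.orbitClosure_subset hx
  exact ⟨hf.homeoOfEquivCompactToT2 (f := Equiv.ofBijective f hbij), fun z => rfl⟩

end Family

section Coding

theorem exists_continuous_injective_nat_to_fin_two {Z : Type*} [TopologicalSpace Z]
    [CompactSpace Z] [TopologicalSpace.MetrizableSpace Z]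
    (hzd : TopologicalSpace.IsTopologicalBasis {s : Set Z | IsClopen s}) :
    ∃ f : Z → ℕ → Fin 2, Continuous f ∧ Function.Injective f := by
  classical
  let _ := TopologicalSpace.metrizableSpaceMetric Z
  have := totallySeparatedSpace_of_t0_of_basis_clopen hzd
  have : Countable (TopologicalSpace.Clopens Z) :=
    TopologicalSpace.Clopens.countable_iff_secondCountable.2 inferInstance
  obtain ⟨C, hC⟩ := exists_surjective_nat (TopologicalSpace.Clopens Z)
  refine ⟨fun z n => if z ∈ C n then 1 else 0, continuous_pi fun n => ?_, fun z z' h => ?_⟩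
  · refine Continuous.if (fun z hz => ?_) continuous_const continuous_const
    exact absurd hz ((C n).isClopen.frontier_eq ▸ notMem_empty z)
  · by_contra hne
    obtain ⟨s, hs, hzs, hsz'⟩ := hzd.exists_subset_of_mem_open (a := z)
      (show z ∈ ({z'}ᶜ : Set Z) from hne) isOpen_compl_singleton
    obtain ⟨n, hn⟩ := hC ⟨s, hs⟩
    have h1 : z ∈ C n := by rw [hn]; exact hzs
    have h2 : z' ∉ C n := by rw [hn]; exact fun h2 => hsz' h2 rfl
    simpa [h1, h2] using congrFun h n

/-- Interleave a binary sequence with the constant letters `0` and `1`. -/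
def padCode (u : ℕ → Fin 2) (n : ℕ) : Fin 2 :=
  if n % 3 = 0 then 0 else if n % 3 = 1 then 1 else u (n / 3)

theorem hasBoundedGaps_padCode (u : ℕ → Fin 2) : HasBoundedGaps (padCode u) := by
  intro j c
  have hc : c = 0 ∨ c = 1 := by omega
  rcases hc with rfl | rfl
  · exact ⟨3 * ((j + 2) / 3), by omega, by omega, if_pos (by omega)⟩
  · refine ⟨3 * ((j + 1) / 3) + 1, by omega, by omega, ?_⟩
    rw [padCode, if_neg (by omega), if_pos (by omega)]

theorem padCode_injective : Function.Injective padCode := fun u v h => by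
  funext n
  have := congrFun h (3 * n + 2)
  have h1 : (3 * n + 2) % 3 = 2 := by omega
  have h2 : (3 * n + 2) / 3 = n := by omega
  simpa [padCode, h1, h2] using this

theorem continuous_padCode : Continuous padCode := by
  refine continuous_pi fun n => ?_
  unfold padCode
  split_ifs <;> fun_prop

end Coding

end CPE

open CPE TopologicalSpace in
/-- For any compact metrizable zero-dimensional space `Z` there exist a finite alphabet
(w.l.o.g. `Fin n`) and a subshift `X ⊆ (Fin n)^ℤ`, each point of which generates a
zero-entropy Toeplitz subshift, together with a continuous open surjection `φ : X → Z`
with `φ ∘ σ = φ`, such that each fiber `φ⁻¹(z)` is a minimal subshift and `z ↦ φ⁻¹(z)` is a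
homeomorphism from `Z` onto the space of minimal subshifts of `X`, the latter topologized by
the Hausdorff distance between (nonempty compact) closed subsets of `X` coming from a
compatible metric on the ambient space. -/
theorem spaces_as_toeplitz_subshifts (Z : Type) [TopologicalSpace Z] [CompactSpace Z]
    [MetrizableSpace Z] (hzd : IsTopologicalBasis {s : Set Z | IsClopen s}) :
    ∃ (n : ℕ) (X : Set (ℤ → Fin n)), IsSubshift X ∧
      (∀ x ∈ X, (∃ t : ℤ → Fin n, IsToeplitz t ∧ orbitClosure x = orbitClosure t) ∧
        HasZeroEntropy (orbitClosure x)) ∧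
      ∃ φ : X → Z, Continuous φ ∧ IsOpenMap φ ∧ Function.Surjective φ ∧
        (∀ (x : ℤ → Fin n) (hx : x ∈ X) (hx' : shiftMap x ∈ X), φ ⟨shiftMap x, hx'⟩ = φ ⟨x, hx⟩) ∧
        (∀ z : Z, IsMinimalSubshift (Subtype.val '' (φ ⁻¹' {z}))) ∧
        (letI : MetricSpace (ℤ → Fin n) := TopologicalSpace.metrizableSpaceMetric _
         ∃ e : Z ≃ₜ {M : NonemptyCompacts (ℤ → Fin n) //
            (M : Set (ℤ → Fin n)) ⊆ X ∧ IsMinimalSubshift (M : Set (ℤ → Fin n))},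
           ∀ z : Z, ((e z : NonemptyCompacts (ℤ → Fin n)) : Set (ℤ → Fin n))
             = Subtype.val '' (φ ⁻¹' {z})) := by
  obtain ⟨f, hf, hfinj⟩ := exists_continuous_injective_nat_to_fin_two hzd
  set w : Z → ℕ → Fin 2 := fun z => padCode (f z)
  have hw : Continuous w := continuous_padCode.comp hf
  have hinj : Function.Injective w := padCode_injective.comp hfinj
  have hgap : ∀ z, HasBoundedGaps (w z) := fun z => hasBoundedGaps_padCode (f z)
  have himage := image_toeplitzIndex_preimage hinj hgap
  refine ⟨2, ⋃ z, toeplitzShift (w z), isSubshift_iUnion_toeplitzShift hw, fun x hx => ?_,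
    toeplitzIndex w, continuous_toeplitzIndex hw hinj hgap, isOpenMap_toeplitzIndex hw hinj hgap,
    fun z => ?_, fun x hx hx' => ?_, fun z => ?_, ?_⟩
  · obtain ⟨z, hz⟩ := mem_iUnion.1 hx
    have horbit := orbitClosure_eq_toeplitzShift (hgap z) hz
    refine ⟨⟨toeplitzPoint (w z), isToeplitz_toeplitzPoint _, ?_⟩, ?_⟩
    · rw [horbit, orbitClosure_eq_toeplitzShift (hgap z) (toeplitzPoint_mem _)]
    · rw [horbit]
      exact hasZeroEntropy_toeplitzShift _
  · exact ⟨⟨_, mem_iUnion.2 ⟨z, toeplitzPoint_mem (w z)⟩⟩,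
      (toeplitzIndex_eq_iff hinj hgap).2 (toeplitzPoint_mem (w z))⟩
  · refine (toeplitzIndex_eq_iff hinj hgap).2 ?_
    exact shiftZ_mem_toeplitzShift 1 ((toeplitzIndex_eq_iff hinj hgap).1 rfl)
  · rw [himage]
    exact isMinimalSubshift_toeplitzShift (hgap z)
  · obtain ⟨e, he⟩ := exists_homeomorph_minimalSubshifts hw hinj hgap
    exact ⟨e, fun z => (he z).trans (himage z).symm⟩
end

section
/- Suppose x ∈ A^ℤ (A a finite alphabet) satisfies: for all i ∈ ℤ and k > 0, there exist j ∈ ℤ and n > 0 such that x_{j+ℓ+mn} = x_{i+ℓ} for all ℓ ∈ [-k,k] and all m ∈ ℤ. Then the orbit closure of x under the shift is a Toeplitz subshift. -/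
open Filter Topology Set

namespace CPE

variable {A : Type*}

/-- The words of radius `k` centred at positions `i` and `j` of `x` coincide. -/
def AgreeAt (x : ℤ → A) (k : ℕ) (i j : ℤ) : Prop :=
  ∀ l : ℤ, |l| ≤ (k : ℤ) → x (i + l) = x (j + l)

/-- The word of radius `k` centred at position `a` of `x` recurs with period `n`. -/
def PeriodicAt (x : ℤ → A) (k n : ℕ) (a : ℤ) : Prop :=
  ∀ l : ℤ, |l| ≤ (k : ℤ) → ∀ m : ℤ, x (a + l + m * n) = x (a + l)

/-- The residues modulo `n` of the occurrences in `x` of the word of radius `k` centred at `p`. -/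
def occurrenceResidues (x : ℤ → A) (n : ℕ) (p : ℤ) (k : ℕ) : Set (ZMod n) :=
  {c | ∃ j : ℤ, (j : ZMod n) = c ∧ AgreeAt x k j p}

theorem AgreeAt.trans {x : ℤ → A} {k : ℕ} {i j p : ℤ} (hij : AgreeAt x k i j)
    (hjp : AgreeAt x k j p) : AgreeAt x k i p :=
  fun l hl => (hij l hl).trans (hjp l hl)

theorem AgreeAt.mono {x : ℤ → A} {k k' : ℕ} {i j : ℤ} (hij : AgreeAt x k' i j) (hk : k ≤ k') :
    AgreeAt x k i j :=
  fun l hl => hij l (by omega)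

theorem AgreeAt.shift {x : ℤ → A} {k k' : ℕ} {i j : ℤ} (hij : AgreeAt x k' i j) (d : ℤ)
    (hk : k + d.natAbs ≤ k') : AgreeAt x k (i + d) (j + d) := by
  intro l hl
  simpa [add_assoc] using hij (d + l) (by rw [abs_le] at *; omega)

/-- If a word recurs with period `n`, some longer word with the same centre forces each of its
occurrences to be surrounded by an `n`-periodic recurrence of the original word. -/
theorem PeriodicAt.exists_forcing_radius {x : ℤ → A} {k n : ℕ} {a : ℤ} (hn : 0 < n)
    (ha : PeriodicAt x k n a) :
    ∃ K : ℕ, k < K ∧ ∀ j : ℤ, AgreeAt x K j a →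
      ∀ l : ℤ, |l| ≤ (k : ℤ) → ∀ m : ℤ, x (j + l + m * n) = x (a + l) := by
  have : NeZero n := ⟨hn.ne'⟩
  obtain ⟨⟨p, r⟩, hmin⟩ : ∃ q : ℤ × ℕ, ∀ q' : ℤ × ℕ,
      (occurrenceResidues x n q.1 q.2).ncard ≤ (occurrenceResidues x n q'.1 q'.2).ncard :=
    ⟨Function.argmin fun q : ℤ × ℕ => (occurrenceResidues x n q.1 q.2).ncard,
      fun q' => Function.argmin_le (fun q : ℤ × ℕ => (occurrenceResidues x n q.1 q.2).ncard) q'⟩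
  simp only [Prod.forall] at hmin
  refine ⟨r + (p - a).natAbs + k + 1, by omega, fun j hj l hl m => ?_⟩
  set K := r + (p - a).natAbs + k + 1 with hK
  have hle : (occurrenceResidues x n a K).ncard ≤ (occurrenceResidues x n p r).ncard := by
    refine Set.ncard_le_ncard_of_injOn (fun c => c + ((p - a : ℤ) : ZMod n)) ?_
      (fun _ _ _ _ h => add_right_cancel h) (Set.toFinite _)
    rintro _ ⟨i, rfl, hi⟩
    refine ⟨i + (p - a), by push_cast; rfl, ?_⟩
    simpa using hi.shift (k := r) (p - a) (by omega)
  set K' := K + (m * n).natAbs with hK'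
  have hsub : occurrenceResidues x n j K' ⊆ occurrenceResidues x n a K := by
    rintro _ ⟨i, rfl, hi⟩
    exact ⟨i, rfl, (hi.mono (by omega)).trans hj⟩
  have heq := Set.eq_of_subset_of_ncard_le hsub (hle.trans (hmin j K')) (Set.toFinite _)
  have hmem : (a : ZMod n) ∈ occurrenceResidues x n j K' := heq ▸ ⟨a, rfl, fun _ _ => rfl⟩
  obtain ⟨i, hia, hi⟩ := hmem
  obtain ⟨s, hs⟩ := (ZMod.intCast_eq_intCast_iff_dvd_sub a i n).1 hia.symm
  have h1 := hi (l + m * n) (by rw [abs_le] at *; omega)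
  have h2 := ha l hl (s + m)
  rw [← h2, add_assoc j, ← h1]
  congr 1
  linear_combination hs

theorem mem_orbitClosure_of_forall [TopologicalSpace A] [DiscreteTopology A] {x y : ℤ → A}
    (h : ∀ k : ℕ, ∃ i : ℤ, ∀ l : ℤ, |l| ≤ (k : ℤ) → y l = x (i + l)) : y ∈ orbitClosure x := by
  choose i hi using h
  refine mem_closure_of_tendsto (f := fun k => shiftZ (i k) x) (b := atTop) ?_
    (Eventually.of_forall fun k => ⟨i k, rfl⟩)
  refine tendsto_pi_nhds.2 fun l => tendsto_nhds_of_eventually_eq ?_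
  filter_upwards [eventually_ge_atTop l.natAbs] with k hk
  rw [shiftZ, add_comm, hi k l (by rw [abs_le]; omega)]

theorem orbitClosure_subset_of_forall [TopologicalSpace A] [DiscreteTopology A] {x y : ℤ → A}
    (h : ∀ (i : ℤ) (k : ℕ), ∃ j : ℤ, ∀ l : ℤ, |l| ≤ (k : ℤ) → y (i + l) = x (j + l)) :
    orbitClosure y ⊆ orbitClosure x := by
  refine closure_minimal ?_ isClosed_closure
  rintro _ ⟨m, rfl⟩
  refine mem_orbitClosure_of_forall fun k => ?_
  obtain ⟨j, hj⟩ := h m k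
  exact ⟨j, fun l hl => by rw [shiftZ, add_comm, hj l hl]⟩

/-- A word of `x` with a centre, a radius and a period with which it recurs. -/
structure PeriodicWord (x : ℤ → A) where
  center : ℤ
  radius : ℕ
  period : ℕ
  period_pos : 0 < period
  periodicAt : PeriodicAt x radius period center

end CPE

open CPE in
/-- If every subword of `x` occurring at position `i` occurs somewhere in `x` along an
arithmetic progression, then the orbit closure of `x` is a Toeplitz subshift, i.e. it is the
orbit closure of some Toeplitz point. -/
theorem orbitClosure_toeplitz {A : Type} [Fintype A] [TopologicalSpace A] [DiscreteTopology A]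
    (x : ℤ → A)
    (h : ∀ i : ℤ, ∀ k : ℕ, 0 < k → ∃ j : ℤ, ∃ n : ℕ, 0 < n ∧
      ∀ l : ℤ, |l| ≤ (k : ℤ) → ∀ m : ℤ, x (j + l + m * n) = x (i + l)) :
    ∃ t : ℤ → A, IsToeplitz t ∧ orbitClosure x = orbitClosure t := by
  have step : ∀ w : PeriodicWord x, ∃ w' : PeriodicWord x, w.radius < w'.radius ∧
      ∀ j : ℤ, AgreeAt x w'.radius j w'.center →
        ∀ l : ℤ, |l| ≤ (w.radius : ℤ) → ∀ m : ℤ,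
          x (j + l + m * w.period) = x (w.center + l) := by
    intro w
    obtain ⟨K, hK, hforce⟩ := w.periodicAt.exists_forcing_radius w.period_pos
    obtain ⟨j, n, hn, hj⟩ := h w.center K (by omega)
    have hjw : AgreeAt x K j w.center := fun l hl => by simpa using hj l hl 0
    exact ⟨⟨j, K, n, hn, fun l hl m => by rw [hj l hl m, hjw l hl]⟩, hK,
      fun i hi => hforce i (hi.trans hjw)⟩
  choose next next_radius next_force using step
  obtain ⟨w₀⟩ : Nonempty (PeriodicWord x) := by
    obtain ⟨j, n, hn, hj⟩ := h 0 1 one_pos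
    exact ⟨⟨j, 1, n, hn, fun l hl m => by rw [hj l hl m]; simpa using (hj l hl 0).symm⟩⟩
  let w : ℕ → PeriodicWord x := fun s => next^[s] w₀
  have w_succ (s : ℕ) : w (s + 1) = next (w s) := Function.iterate_succ_apply' next s w₀
  have radius_mono : StrictMono fun s => (w s).radius :=
    strictMono_nat_of_lt_succ fun s => by simpa only [w_succ] using next_radius (w s)
  have le_radius (s : ℕ) : s ≤ (w s).radius := radius_mono.le_apply
  have agree_succ (s : ℕ) : AgreeAt x (w s).radius (w (s + 1)).center (w s).center := by
    intro l hl
    rw [w_succ]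
    simpa using next_force (w s) _ (fun _ _ => rfl) l hl 0
  have agree {s r : ℕ} (hsr : s ≤ r) : AgreeAt x (w s).radius (w r).center (w s).center := by
    induction r, hsr using Nat.le_induction with
    | base => exact fun _ _ => rfl
    | succ r hsr ih => exact ((agree_succ r).mono (radius_mono.monotone hsr)).trans ih
  let t : ℤ → A := fun l => x ((w l.natAbs).center + l)
  have t_eq {l : ℤ} {r : ℕ} (hr : l.natAbs ≤ r) : t l = x ((w r).center + l) :=
    (agree hr l (by have := le_radius l.natAbs; rw [abs_le]; omega)).symm
  refine ⟨t, fun i => ?_, Subset.antisymm ?_ ?_⟩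
  · refine ⟨(w i.natAbs).period, (w i.natAbs).period_pos, fun m => ?_⟩
    set s := i.natAbs
    set d := m * ((w s).period : ℤ)
    have hag := agree (s := s + 1) (r := s + 1 + (i + d).natAbs) (by omega)
    rw [t_eq (l := i + d) (r := s + 1 + (i + d).natAbs) (by omega), ← add_assoc]
    rw [w_succ] at hag
    exact next_force (w s) _ hag i (by have := le_radius s; rw [abs_le]; omega) m
  · refine orbitClosure_subset_of_forall fun i k => ?_
    obtain ⟨j, n, hn, hj⟩ := h i (k + 1) (by omega)
    set r := k + n with hr
    set c := (w r).center
    refine ⟨(j - c) % n, fun l hl => ?_⟩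
    have h0 := Int.emod_nonneg (j - c) (b := (n : ℤ)) (by omega)
    have h1 := Int.emod_lt_of_pos (j - c) (b := (n : ℤ)) (by omega)
    have h2 := Int.emod_add_mul_ediv (j - c) n
    rw [t_eq (r := r) (by rw [abs_le] at hl; omega), ← hj l (by push_cast; omega) (-((j - c) / n))]
    congr 1
    linear_combination -h2
  · refine orbitClosure_subset_of_forall fun i k => ?_
    refine ⟨(w (i.natAbs + k)).center + i, fun l hl => ?_⟩
    rw [t_eq (r := i.natAbs + k) (by rw [abs_le] at hl; omega), add_assoc]
end

section
/- Let X and Y be first-countable topological spaces and f : X → Y a quotient map. Then f is open if and only if: whenever (y_i) is a sequence in Y with lim_i y_i = y and f(x) = y, there exists a sequence (x_i) in X with f(x_i) = y_i for all i and lim_i x_i = x. -/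
open Filter Topology

/-- A sequence converging along `map g l`, with `l` countably generated and `g` surjective,
lifts to a sequence converging along `l`. -/
theorem exists_seq_lift_of_tendsto_map {α β : Type*} {g : α → β} (hg : Function.Surjective g)
    {l : Filter α} [l.IsCountablyGenerated] {u : ℕ → β} (hu : Tendsto u atTop (map g l)) :
    ∃ v : ℕ → α, (∀ i, g (v i) = u i) ∧ Tendsto v atTop l := by
  classical
  obtain ⟨s, hs⟩ := l.exists_antitone_basis
  have key : ∀ i, ∃ a, g a = u i ∧ ∀ n ≤ i, u i ∈ g '' s n → a ∈ s n := by
    intro i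
    by_cases h : ∃ n ≤ i, u i ∈ g '' s n
    · obtain ⟨m, hm, hum⟩ := h
      obtain ⟨a, ha, hau⟩ := Nat.findGreatest_spec (P := fun n ↦ u i ∈ g '' s n) hm hum
      exact ⟨a, hau, fun n hn hun ↦ hs.antitone (Nat.le_findGreatest hn hun) ha⟩
    · obtain ⟨a, ha⟩ := hg (u i)
      exact ⟨a, ha, fun n hn hun ↦ (h ⟨n, hn, hun⟩).elim⟩
  choose v hv hvs using key
  refine ⟨v, hv, hs.tendsto_right_iff.2 fun n _ ↦ ?_⟩
  filter_upwards [hu (image_mem_map (hs.mem n)), eventually_ge_atTop n] with i hi hn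
  exact hvs i n hn hi

/-- A quotient map between first-countable spaces is open if and only if convergent sequences
in the target can be lifted through any prescribed preimage of the limit: whenever
`y_i → y` and `f x = y`, there are `x_i` with `f x_i = y_i` and `x_i → x`. -/
theorem isOpenMap_iff_sequence_lifting {X Y : Type*} [TopologicalSpace X] [TopologicalSpace Y]
    [FirstCountableTopology X] [FirstCountableTopology Y]
    (f : X → Y) (hq : Topology.IsQuotientMap f) :
    IsOpenMap f ↔
      ∀ (y : ℕ → Y) (ylim : Y) (x : X), Tendsto y atTop (nhds ylim) → f x = ylim →
        ∃ x' : ℕ → X, (∀ i, f (x' i) = y i) ∧ Tendsto x' atTop (nhds x) := by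
  rw [isOpenMap_iff_nhds_le]
  constructor
  · rintro hf y _ x hy rfl
    exact exists_seq_lift_of_tendsto_map hq.surjective (hy.mono_right (hf x))
  · intro h x
    refine tendsto_id'.1 (tendsto_of_seq_tendsto fun y hy ↦ ?_)
    obtain ⟨x', hx', hlim⟩ := h y (f x) x hy rfl
    exact (tendsto_map.comp hlim).congr hx'
end
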